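/- arXiv:2007.10104 — 4 statements merged into one kernel-verified Lean document; each statement's English description precedes it below -/
import Mathlib

section
/- Let φ : [0,∞) → [0,∞) be increasing and concave with φ(0) = 0 and φ(t) → ∞ as t → ∞. Let f : ℝ^n → ℝ be measurable and K > 0, and suppose that for every axis-parallel cube Q there exists c_Q ∈ ℝ with ⨍_Q φ(|f − c_Q|/K) dx ≤ 1. Then f is locally integrable and for every axis-parallel cube Q there exists c ∈ ℝ with ⨍_Q |f − c| dx ≤ ( 2 φ⁻¹(4) + φ⁻¹(2 + 2^{n+2}) ) · K. In particular ‖f‖_{BMO} ≤ 2( 2 φ⁻¹(4) + φ⁻¹(2 + 2^{n+2}) ) ‖f‖_{BMO_φ}. -/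
open MeasureTheory Set Filter

/-- An axis-parallel cube of positive side length in `ℝⁿ`. -/
def IsCube (n : ℕ) (Q : Set (Fin n → ℝ)) : Prop :=
  ∃ (a : Fin n → ℝ) (h : ℝ), 0 < h ∧ Q = Set.univ.pi fun i => Set.Icc (a i) (a i + h)

open scoped ENNReal Topology

variable {n : ℕ}

/-- The half-open cube with corner `a` and side length `h`. -/
def halfOpenCube (a : Fin n → ℝ) (h : ℝ) : Set (Fin n → ℝ) :=
  univ.pi fun i => Ico (a i) (a i + h)

theorem measurableSet_halfOpenCube (a : Fin n → ℝ) (h : ℝ) :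
    MeasurableSet (halfOpenCube a h) :=
  MeasurableSet.univ_pi fun _ => measurableSet_Ico

theorem volume_halfOpenCube (a : Fin n → ℝ) (h : ℝ) :
    volume (halfOpenCube a h) = ENNReal.ofReal h ^ n := by
  simp [halfOpenCube, Real.volume_pi_Ico]

theorem volume_halfOpenCube_ne_zero (a : Fin n → ℝ) {h : ℝ} (hh : 0 < h) :
    volume (halfOpenCube a h) ≠ 0 := by
  rw [volume_halfOpenCube]
  exact pow_ne_zero _ (by simpa using hh)

theorem volume_halfOpenCube_ne_top (a : Fin n → ℝ) (h : ℝ) :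
    volume (halfOpenCube a h) ≠ ∞ := by
  rw [volume_halfOpenCube]
  exact ENNReal.pow_ne_top ENNReal.ofReal_ne_top

theorem halfOpenCube_ae_eq (a : Fin n → ℝ) (h : ℝ) :
    halfOpenCube a h =ᵐ[volume] univ.pi fun i => Icc (a i) (a i + h) := by
  rw [pi_univ_Icc]
  exact Measure.univ_pi_Ico_ae_eq_Icc

theorem halfOpenCube_ae_eq_closedBall (a : Fin n → ℝ) {h : ℝ} (hh : 0 ≤ h) :
    halfOpenCube a h =ᵐ[volume] Metric.closedBall (fun i => a i + h / 2) (h / 2) := by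
  refine (halfOpenCube_ae_eq a h).trans (Eq.eventuallyEq ?_)
  rw [closedBall_pi _ (by positivity)]
  refine Set.pi_congr rfl fun i _ => ?_
  rw [Real.closedBall_eq_Icc]
  congr 1 <;> ring

/-- The `z`-th cell of the `k`-th dyadic subdivision of the grid generated by the cube with
corner `a` and side length `h`. -/
def dyadicCell (a : Fin n → ℝ) (h : ℝ) (k : ℕ) (z : Fin n → ℤ) : Set (Fin n → ℝ) :=
  halfOpenCube (fun i => a i + h / 2 ^ k * z i) (h / 2 ^ k)

/-- The index of the cell of the `k`-th dyadic subdivision containing `x`. -/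
noncomputable def dyadicIndex (a : Fin n → ℝ) (h : ℝ) (k : ℕ) (x : Fin n → ℝ) : Fin n → ℤ :=
  fun i => ⌊(x i - a i) / h * 2 ^ k⌋

section Dyadic

variable {a : Fin n → ℝ} {h : ℝ}

theorem mem_dyadicCell_iff (hh : 0 < h) {k : ℕ} {z : Fin n → ℤ} {x : Fin n → ℝ} :
    x ∈ dyadicCell a h k z ↔ dyadicIndex a h k x = z := by
  simp only [dyadicCell, halfOpenCube, mem_univ_pi, funext_iff, dyadicIndex]
  refine forall_congr' fun i => ?_
  rw [Int.floor_eq_iff, mem_Ico]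
  have hp : (0 : ℝ) < h / 2 ^ k := by positivity
  have e : (x i - a i) / h * 2 ^ k = (x i - a i) / (h / 2 ^ k) := by field_simp
  rw [e, le_div_iff₀ hp, div_lt_iff₀ hp]
  constructor <;> rintro ⟨h1, h2⟩ <;> constructor <;> linarith

theorem dyadicCell_zero (a : Fin n → ℝ) (h : ℝ) : dyadicCell a h 0 0 = halfOpenCube a h := by
  simp [dyadicCell]

theorem dyadicIndex_eq_div (a : Fin n → ℝ) (h : ℝ) (j m : ℕ) (x : Fin n → ℝ) :
    dyadicIndex a h j x = fun i => dyadicIndex a h (j + m) x i / 2 ^ m := by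
  funext i
  have := Int.mul_cast_floor_div_cancel_of_pos (n := 2 ^ m) (by positivity)
    ((x i - a i) / h * 2 ^ j)
  simp only [dyadicIndex]
  rw [← this]
  push_cast
  rw [pow_add, mul_assoc]

theorem dyadicCell_subset (hh : 0 < h) {j k : ℕ} (hjk : j ≤ k) {z w : Fin n → ℤ}
    {x : Fin n → ℝ} (hz : x ∈ dyadicCell a h k z) (hw : x ∈ dyadicCell a h j w) :
    dyadicCell a h k z ⊆ dyadicCell a h j w := by
  intro y hy
  rw [mem_dyadicCell_iff hh] at *
  obtain ⟨m, rfl⟩ := Nat.exists_eq_add_of_le hjk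
  rw [dyadicIndex_eq_div a h j m, hy, ← hz, ← dyadicIndex_eq_div, hw]

theorem mem_dyadicCell_self (hh : 0 < h) (k : ℕ) (x : Fin n → ℝ) :
    x ∈ dyadicCell a h k (dyadicIndex a h k x) :=
  (mem_dyadicCell_iff hh).2 rfl

theorem dyadicCell_nonempty (hh : 0 < h) (k : ℕ) (z : Fin n → ℤ) :
    (dyadicCell a h k z).Nonempty := by
  refine ⟨fun i => a i + h / 2 ^ k * z i, ?_⟩
  have : 0 < h / 2 ^ k := by positivity
  simp [dyadicCell, halfOpenCube, this]

theorem volume_dyadicCell_succ (k : ℕ) (z w : Fin n → ℤ) :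
    volume (dyadicCell a h k w) = 2 ^ n * volume (dyadicCell a h (k + 1) z) := by
  simp only [dyadicCell, volume_halfOpenCube]
  rw [← mul_pow]
  congr 1
  rw [← ENNReal.ofReal_ofNat 2, ← ENNReal.ofReal_mul (by norm_num)]
  congr 1
  field_simp
  ring

/-- Lebesgue differentiation along dyadic cells. -/
theorem ae_tendsto_lintegral_dyadicCell_div (hh : 0 < h) {g : (Fin n → ℝ) → ℝ≥0∞}
    (hg : AEMeasurable g) (hfin : ∫⁻ x, g x ≠ ∞) :
    ∀ᵐ x, Tendsto (fun k => (∫⁻ y in dyadicCell a h k (dyadicIndex a h k x), g y) /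
      volume (dyadicCell a h k (dyadicIndex a h k x))) atTop (𝓝 (g x)) := by
  filter_upwards [(IsUnifLocDoublingMeasure.vitaliFamily
    (volume : Measure (Fin n → ℝ)) 1).ae_tendsto_lintegral_div hg hfin] with x hx
  have hlim : Tendsto (fun k : ℕ => h / 2 ^ k / 2) atTop (𝓝[>] 0) := by
    refine tendsto_nhdsWithin_iff.2 ⟨?_, Eventually.of_forall fun k => by
      simp only [mem_Ioi]; positivity⟩
    have := (tendsto_pow_atTop_nhds_zero_of_lt_one (r := (1 / 2 : ℝ)) (by norm_num)
      (by norm_num)).const_mul (h / 2)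
    rw [mul_zero] at this
    refine this.congr fun k => ?_
    rw [div_pow, one_pow]
    ring
  have key := hx.comp (IsUnifLocDoublingMeasure.tendsto_closedBall_filterAt volume (K := 1) (x := x)
    (fun (k : ℕ) i => (a i + h / 2 ^ k * dyadicIndex a h k x i) + h / 2 ^ k / 2) _ hlim
    (Eventually.of_forall fun k => ?_))
  · refine key.congr fun k => ?_
    have e : dyadicCell a h k (dyadicIndex a h k x) =ᵐ[volume] _ :=
      halfOpenCube_ae_eq_closedBall _ (by positivity)
    simp only [Function.comp]
    rw [setLIntegral_congr e, measure_congr e]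
  · have hx := mem_dyadicCell_self (a := a) hh k x
    have hp : 0 < h / 2 ^ k := by positivity
    rw [one_mul, closedBall_pi _ (by positivity)]
    simp only [dyadicCell, halfOpenCube, mem_univ_pi, mem_Ico] at hx
    simp only [mem_univ_pi, Real.closedBall_eq_Icc, mem_Icc]
    intro i
    constructor <;> linarith [hx i]

/-- The Calderón–Zygmund decomposition of a cube at height `l`. -/
theorem exists_calderonZygmund_decomposition (a : Fin n → ℝ) (hh : 0 < h)
    {g : (Fin n → ℝ) → ℝ≥0∞} (hg : Measurable g) {l : ℝ≥0∞} (hl : l ≠ ∞)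
    (hle : ∫⁻ x in halfOpenCube a h, g x ≤ l * volume (halfOpenCube a h)) :
    ∃ J : Set (ℕ × (Fin n → ℤ)), J.PairwiseDisjoint (fun p => dyadicCell a h p.1 p.2) ∧
      (∀ p ∈ J, dyadicCell a h p.1 p.2 ⊆ halfOpenCube a h ∧
        l * volume (dyadicCell a h p.1 p.2) ≤ ∫⁻ x in dyadicCell a h p.1 p.2, g x ∧
        ∫⁻ x in dyadicCell a h p.1 p.2, g x ≤ l * 2 ^ n * volume (dyadicCell a h p.1 p.2)) ∧
      ∀ᵐ x, x ∈ halfOpenCube a h → x ∉ ⋃ p ∈ J, dyadicCell a h p.1 p.2 → g x ≤ l := by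
  set Bad : ℕ → (Fin n → ℤ) → Prop := fun k z =>
    l * volume (dyadicCell a h k z) < ∫⁻ x in dyadicCell a h k z, g x with hBad
  refine ⟨{p | Bad p.1 p.2 ∧ dyadicCell a h p.1 p.2 ⊆ halfOpenCube a h ∧
    ∀ j < p.1, ∀ w, dyadicCell a h p.1 p.2 ⊆ dyadicCell a h j w → ¬ Bad j w}, ?_, ?_, ?_⟩
  · have aux : ∀ k z j w, j ≤ k → Bad j w →
        (∀ j < k, ∀ w, dyadicCell a h k z ⊆ dyadicCell a h j w → ¬ Bad j w) →
        ∀ x ∈ dyadicCell a h k z, x ∈ dyadicCell a h j w → (k, z) = (j, w) := by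
      intro k z j w hjk hb hmax x hz hw
      rcases hjk.lt_or_eq with hlt | rfl
      · exact absurd hb (hmax j hlt w (dyadicCell_subset hh hjk hz hw))
      · rw [mem_dyadicCell_iff hh] at hz hw
        rw [← hz, ← hw]
    rintro ⟨k, z⟩ ⟨hb, -, hmax⟩ ⟨j, w⟩ ⟨hb', -, hmax'⟩ hne
    refine Set.disjoint_left.2 fun x hz hw => hne ?_
    rcases le_total j k with hjk | hjk
    · exact aux k z j w hjk hb' hmax x hz hw
    · exact (aux j w k z hjk hb hmax' x hw hz).symm
  · rintro ⟨k, z⟩ ⟨hb, hsub, hmax⟩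
    refine ⟨hsub, hb.le, ?_⟩
    obtain ⟨x, hx⟩ := dyadicCell_nonempty (a := a) hh k z
    rcases k with _ | k
    · exfalso
      have hx0 := hsub hx
      simp only at hx hb
      rw [← dyadicCell_zero, mem_dyadicCell_iff hh] at hx0
      rw [mem_dyadicCell_iff hh] at hx
      rw [← hx, hx0] at hb
      simp only [hBad, dyadicCell_zero] at hb
      exact absurd hb hle.not_gt
    · have hs := dyadicCell_subset hh k.le_succ hx (mem_dyadicCell_self hh k x)
      have hnb := hmax k k.lt_succ_self _ hs
      simp only [hBad, not_lt] at hnb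
      calc ∫⁻ x in dyadicCell a h (k + 1) z, g x
          ≤ ∫⁻ y in dyadicCell a h k (dyadicIndex a h k x), g y := lintegral_mono_set hs
        _ ≤ l * volume (dyadicCell a h k (dyadicIndex a h k x)) := hnb
        _ = _ := by rw [volume_dyadicCell_succ k z, mul_assoc]
  · have hQ := measurableSet_halfOpenCube a h
    have hfin : ∫⁻ x, (halfOpenCube a h).indicator g x ≠ ∞ := by
      rw [lintegral_indicator hQ]
      exact (hle.trans_lt (ENNReal.mul_lt_top hl.lt_top
        (volume_halfOpenCube_ne_top a h).lt_top)).ne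
    filter_upwards [ae_tendsto_lintegral_dyadicCell_div (a := a) hh
      (hg.indicator hQ).aemeasurable hfin] with x hlim hxQ hxU
    have hnb : ∀ k, ¬ Bad k (dyadicIndex a h k x) := by
      by_contra! hex
      classical
      refine hxU (mem_iUnion₂.2 ⟨(Nat.find hex, dyadicIndex a h (Nat.find hex) x),
        ⟨Nat.find_spec hex, ?_, fun j hj w hw hb => ?_⟩, mem_dyadicCell_self hh _ x⟩)
      · rw [← dyadicCell_zero] at hxQ ⊢
        exact dyadicCell_subset hh (Nat.zero_le _) (mem_dyadicCell_self hh _ x) hxQ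
      · have := (mem_dyadicCell_iff hh).1 (hw (mem_dyadicCell_self hh _ x))
        exact Nat.find_min hex hj (this ▸ hb)
    rw [indicator_of_mem hxQ] at hlim
    refine le_of_tendsto hlim (Eventually.of_forall fun k => ?_)
    refine ENNReal.div_le_of_le_mul ?_
    refine le_trans ?_ (not_lt.1 (hnb k))
    exact lintegral_mono fun y => indicator_le_self _ g y

end Dyadic

theorem le_inv_of_le {φ φinv : ℝ → ℝ} (hmono : MonotoneOn φ (Ici 0))
    (hright : ∀ s, 0 ≤ s → φ (φinv s) = s) (hleft : ∀ t, 0 ≤ t → φinv (φ t) = t)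
    (hinv_nonneg : ∀ s, 0 ≤ s → 0 ≤ φinv s) {s t : ℝ} (hs : 0 ≤ s) (ht : 0 ≤ t)
    (hts : φ t ≤ s) : t ≤ φinv s := by
  by_contra! hlt
  have h1 : s ≤ φ t := hright s hs ▸ hmono (hinv_nonneg s hs) ht hlt.le
  have h2 := hleft t ht
  rw [le_antisymm hts h1] at h2
  exact hlt.ne h2

theorem ConcaveOn.map_add_le_of_zero {φ : ℝ → ℝ} (hconc : ConcaveOn ℝ (Ici 0) φ)
    (hzero : φ 0 = 0) {s t : ℝ} (hs : 0 ≤ s) (ht : 0 ≤ t) : φ (s + t) ≤ φ s + φ t := by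
  rcases (add_nonneg hs ht).eq_or_lt with h | h
  · obtain rfl : s = 0 := by linarith
    obtain rfl : t = 0 := by linarith
    simp [hzero]
  · have key : ∀ u, 0 ≤ u → u ≤ s + t → u / (s + t) * φ (s + t) ≤ φ u := by
      intro u hu hle
      have := hconc.2 (mem_Ici.2 h.le) (mem_Ici.2 (le_refl (0 : ℝ)))
        (show 0 ≤ u / (s + t) by positivity)
        (sub_nonneg.2 ((div_le_one h).2 hle)) (by ring)
      simp only [smul_eq_mul, hzero, mul_zero, add_zero] at this
      rwa [div_mul_cancel₀ _ h.ne'] at this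
    have e : s / (s + t) * φ (s + t) + t / (s + t) * φ (s + t) = φ (s + t) := by
      field_simp
    linarith [key s hs (by linarith), key t ht (by linarith)]

section Oscillation

variable {φ φinv : ℝ → ℝ} {f : (Fin n → ℝ) → ℝ} {K : ℝ}

theorem measurable_ofReal_comp_abs_sub_div (hmono : MonotoneOn φ (Ici 0)) (hf : Measurable f)
    (hK : 0 < K) (c : ℝ) : Measurable fun x => ENNReal.ofReal (φ (|f x - c| / K)) := by
  have hm : Monotone fun t => φ (max t 0) := fun s t hst =>
    hmono (mem_Ici.2 (le_max_right _ _)) (mem_Ici.2 (le_max_right _ _)) (max_le_max_right 0 hst)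
  have : (fun x => ENNReal.ofReal (φ (|f x - c| / K))) =
      fun x => ENNReal.ofReal ((fun t => φ (max t 0)) (|f x - c| / K)) := by
    funext x
    simp only
    rw [max_eq_left (by positivity)]
  rw [this]
  exact (hm.measurable.comp ((hf.sub_const c).abs.div_const K)).ennreal_ofReal

/-- Two constants adapted to a cube differ by a controlled amount. -/
theorem abs_sub_le_of_lintegral_le (hmono : MonotoneOn φ (Ici 0))
    (hconc : ConcaveOn ℝ (Ici 0) φ) (hzero : φ 0 = 0) (hnonneg : ∀ t, 0 ≤ t → 0 ≤ φ t)
    (hright : ∀ s, 0 ≤ s → φ (φinv s) = s) (hleft : ∀ t, 0 ≤ t → φinv (φ t) = t)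
    (hinv_nonneg : ∀ s, 0 ≤ s → 0 ≤ φinv s) (hf : Measurable f) (hK : 0 < K)
    {s : Set (Fin n → ℝ)} (hs0 : volume s ≠ 0) (hs : volume s ≠ ∞) {c d A B : ℝ}
    (hA : 0 ≤ A) (hB : 0 ≤ B)
    (hc : ∫⁻ x in s, ENNReal.ofReal (φ (|f x - c| / K)) ≤ ENNReal.ofReal A * volume s)
    (hd : ∫⁻ x in s, ENNReal.ofReal (φ (|f x - d| / K)) ≤ ENNReal.ofReal B * volume s) :
    |c - d| ≤ φinv (A + B) * K := by
  rw [← div_le_iff₀ hK]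
  refine le_inv_of_le hmono hright hleft hinv_nonneg (by positivity) (by positivity) ?_
  rw [← ENNReal.ofReal_le_ofReal_iff (by positivity), ← ENNReal.mul_le_mul_iff_left hs0 hs]
  calc ENNReal.ofReal (φ (|c - d| / K)) * volume s
      = ∫⁻ _ in s, ENNReal.ofReal (φ (|c - d| / K)) := by simp
    _ ≤ ∫⁻ x in s, (ENNReal.ofReal (φ (|f x - c| / K)) + ENNReal.ofReal (φ (|f x - d| / K))) := by
        refine lintegral_mono fun x => ?_
        rw [← ENNReal.ofReal_add (hnonneg _ (by positivity)) (hnonneg _ (by positivity))]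
        refine ENNReal.ofReal_le_ofReal (le_trans (hmono ?_ ?_ ?_)
          (hconc.map_add_le_of_zero hzero (by positivity) (by positivity)))
        · exact mem_Ici.2 (by positivity)
        · exact mem_Ici.2 (by positivity)
        · rw [← add_div]
          refine div_le_div_of_nonneg_right ?_ hK.le
          have := abs_sub_le c (f x) d
          rwa [abs_sub_comm c (f x)] at this
    _ ≤ ENNReal.ofReal (A + B) * volume s := by
        rw [lintegral_add_left (measurable_ofReal_comp_abs_sub_div hmono hf hK c),
          ENNReal.ofReal_add hA hB, add_mul]
        exact add_le_add hc hd

/-- A uniform bound `C` on the mean oscillation self-improves to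
`φinv 4 * K + (φinv (1 + 4 * 2 ^ n) * K + C) / 4`. -/
theorem meanOscillation_improve (hmono : MonotoneOn φ (Ici 0))
    (hconc : ConcaveOn ℝ (Ici 0) φ) (hzero : φ 0 = 0) (hnonneg : ∀ t, 0 ≤ t → 0 ≤ φ t)
    (hright : ∀ s, 0 ≤ s → φ (φinv s) = s) (hleft : ∀ t, 0 ≤ t → φinv (φ t) = t)
    (hinv_nonneg : ∀ s, 0 ≤ s → 0 ≤ φinv s) (hf : Measurable f) (hK : 0 < K)
    {c : (Fin n → ℝ) → ℝ → ℝ}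
    (hc : ∀ a h, 0 < h → ∫⁻ x in halfOpenCube a h, ENNReal.ofReal (φ (|f x - c a h| / K)) ≤
      volume (halfOpenCube a h))
    {C : ℝ} (hC : 0 ≤ C)
    (hosc : ∀ a h, 0 < h → ∫⁻ x in halfOpenCube a h, ENNReal.ofReal |f x - c a h| ≤
      ENNReal.ofReal C * volume (halfOpenCube a h))
    (a : Fin n → ℝ) {h : ℝ} (hh : 0 < h) :
    ∫⁻ x in halfOpenCube a h, ENNReal.ofReal |f x - c a h| ≤
      ENNReal.ofReal (φinv 4 * K + (φinv (1 + 4 * 2 ^ n) * K + C) / 4) *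
        volume (halfOpenCube a h) := by
  set Q := halfOpenCube a h with hQ
  set c₀ := c a h with hc₀
  set β := φinv (1 + 4 * 2 ^ n) * K with hβ
  have hβ0 : 0 ≤ β := mul_nonneg (hinv_nonneg _ (by positivity)) hK.le
  have hα0 : 0 ≤ φinv 4 * K := mul_nonneg (hinv_nonneg _ (by positivity)) hK.le
  set g : (Fin n → ℝ) → ℝ≥0∞ := fun x => ENNReal.ofReal (φ (|f x - c₀| / K)) with hg
  set F : (Fin n → ℝ) → ℝ≥0∞ := fun x => ENNReal.ofReal |f x - c₀| with hF
  have hgm : Measurable g := measurable_ofReal_comp_abs_sub_div hmono hf hK c₀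
  obtain ⟨J, hdisj, hJ, hae⟩ := exists_calderonZygmund_decomposition a hh hgm
    (l := 4) (by norm_num) ((hc a h hh).trans (le_mul_of_one_le_left' (by norm_num)))
  have hJc : J.Countable := J.to_countable
  have hmeas : ∀ p ∈ J, MeasurableSet (dyadicCell a h p.1 p.2) := fun p _ =>
    measurableSet_halfOpenCube _ _
  set U := ⋃ p ∈ J, dyadicCell a h p.1 p.2 with hU
  have hUm : MeasurableSet U := MeasurableSet.biUnion hJc hmeas
  have hUQ : U ⊆ Q := iUnion₂_subset fun p hp => (hJ p hp).1
  have hcell : ∀ p ∈ J, ∫⁻ x in dyadicCell a h p.1 p.2, F x ≤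
      ENNReal.ofReal (β + C) * volume (dyadicCell a h p.1 p.2) := by
    intro p hp
    set a' : Fin n → ℝ := fun i => a i + h / 2 ^ p.1 * p.2 i
    have hh' : 0 < h / 2 ^ p.1 := by positivity
    have hdiff : |c a' (h / 2 ^ p.1) - c₀| ≤ β := by
      refine abs_sub_le_of_lintegral_le hmono hconc hzero hnonneg hright hleft hinv_nonneg hf hK
        (volume_halfOpenCube_ne_zero a' hh') (volume_halfOpenCube_ne_top a' _) zero_le_one
        (by positivity) ?_ ?_
      · simpa using hc a' _ hh'
      · refine (hJ p hp).2.2.trans (le_of_eq ?_)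
        congr 1
        rw [ENNReal.ofReal_mul (by norm_num), ENNReal.ofReal_pow (by norm_num)]
        simp
    calc ∫⁻ x in dyadicCell a h p.1 p.2, F x
        ≤ ∫⁻ x in dyadicCell a h p.1 p.2,
            (ENNReal.ofReal β + ENNReal.ofReal |f x - c a' (h / 2 ^ p.1)|) := by
          refine lintegral_mono fun x => ?_
          rw [← ENNReal.ofReal_add hβ0 (abs_nonneg _)]
          refine ENNReal.ofReal_le_ofReal ?_
          linarith [abs_sub_le (f x) (c a' (h / 2 ^ p.1)) c₀]
      _ ≤ _ := by
          rw [lintegral_add_left measurable_const, setLIntegral_const,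
            ENNReal.ofReal_add hβ0 hC, add_mul]
          exact add_le_add le_rfl (hosc a' _ hh')
  have hvol : 4 * ∑' p : J, volume (dyadicCell a h p.1.1 p.1.2) ≤ volume Q := by
    rw [← ENNReal.tsum_mul_left]
    calc ∑' p : J, 4 * volume (dyadicCell a h p.1.1 p.1.2)
        ≤ ∑' p : J, ∫⁻ x in dyadicCell a h p.1.1 p.1.2, g x :=
          ENNReal.tsum_le_tsum fun p => (hJ p p.2).2.1
      _ = ∫⁻ x in U, g x := (lintegral_biUnion hJc hmeas hdisj g).symm
      _ ≤ ∫⁻ x in Q, g x := lintegral_mono_set hUQ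
      _ ≤ volume Q := hc a h hh
  have hbad : ∫⁻ x in U, F x ≤ ENNReal.ofReal ((β + C) / 4) * volume Q := by
    calc ∫⁻ x in U, F x = ∑' p : J, ∫⁻ x in dyadicCell a h p.1.1 p.1.2, F x :=
          lintegral_biUnion hJc hmeas hdisj F
      _ ≤ ∑' p : J, ENNReal.ofReal (β + C) * volume (dyadicCell a h p.1.1 p.1.2) :=
          ENNReal.tsum_le_tsum fun p => hcell p p.2
      _ = ENNReal.ofReal ((β + C) / 4) * (4 * ∑' p : J, volume (dyadicCell a h p.1.1 p.1.2)) := by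
          rw [ENNReal.tsum_mul_left, ← mul_assoc, ← ENNReal.ofReal_ofNat 4,
            ← ENNReal.ofReal_mul (by positivity), div_mul_cancel₀ _ (by norm_num)]
      _ ≤ _ := by gcongr
  have hgood : ∫⁻ x in Q \ U, F x ≤ ENNReal.ofReal (φinv 4 * K) * volume Q := by
    calc ∫⁻ x in Q \ U, F x ≤ ∫⁻ _ in Q \ U, ENNReal.ofReal (φinv 4 * K) := by
          refine lintegral_mono_ae ?_
          filter_upwards [ae_restrict_of_ae hae,
            ae_restrict_mem ((measurableSet_halfOpenCube a h).diff hUm)] with x hx hxm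
          refine ENNReal.ofReal_le_ofReal ?_
          rw [← div_le_iff₀ hK]
          refine le_inv_of_le hmono hright hleft hinv_nonneg (by norm_num) (by positivity) ?_
          have := hx hxm.1 hxm.2
          rw [← ENNReal.ofReal_ofNat 4] at this
          exact (ENNReal.ofReal_le_ofReal_iff (by norm_num)).1 this
      _ ≤ _ := by
          rw [setLIntegral_const]
          gcongr
          exact sdiff_subset
  rw [← lintegral_inter_add_sdiff F Q hUm, inter_eq_self_of_subset_right hUQ,
    ENNReal.ofReal_add hα0 (by positivity), add_mul, add_comm]
  exact add_le_add hgood hbad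

/-- A finite uniform bound on the mean oscillation forces the explicit bound. -/
theorem meanOscillation_le_of_bounded (hmono : MonotoneOn φ (Ici 0))
    (hconc : ConcaveOn ℝ (Ici 0) φ) (hzero : φ 0 = 0) (hnonneg : ∀ t, 0 ≤ t → 0 ≤ φ t)
    (hright : ∀ s, 0 ≤ s → φ (φinv s) = s) (hleft : ∀ t, 0 ≤ t → φinv (φ t) = t)
    (hinv_nonneg : ∀ s, 0 ≤ s → 0 ≤ φinv s) (hf : Measurable f) (hK : 0 < K)
    {c : (Fin n → ℝ) → ℝ → ℝ}
    (hc : ∀ a h, 0 < h → ∫⁻ x in halfOpenCube a h, ENNReal.ofReal (φ (|f x - c a h| / K)) ≤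
      volume (halfOpenCube a h))
    {C : ℝ} (hC : 0 ≤ C)
    (hosc : ∀ a h, 0 < h → ∫⁻ x in halfOpenCube a h, ENNReal.ofReal |f x - c a h| ≤
      ENNReal.ofReal C * volume (halfOpenCube a h))
    (a : Fin n → ℝ) {h : ℝ} (hh : 0 < h) :
    ∫⁻ x in halfOpenCube a h, ENNReal.ofReal |f x - c a h| ≤
      ENNReal.ofReal ((4 * φinv 4 + φinv (1 + 4 * 2 ^ n)) / 3 * K) *
        volume (halfOpenCube a h) := by
  set D := (4 * φinv 4 + φinv (1 + 4 * 2 ^ n)) / 3 * K with hD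
  have hD0 : 0 ≤ D := by
    have h1 := hinv_nonneg 4 (by norm_num)
    have h2 := hinv_nonneg (1 + 4 * 2 ^ n) (by positivity)
    positivity
  have hiter : ∀ k : ℕ, ∀ a h, 0 < h →
      ∫⁻ x in halfOpenCube a h, ENNReal.ofReal |f x - c a h| ≤
        ENNReal.ofReal (D + C * (1 / 4) ^ k) * volume (halfOpenCube a h) := by
    intro k
    induction k with
    | zero =>
      intro a h hh
      refine (hosc a h hh).trans ?_
      gcongr
      simpa using hD0
    | succ k ih =>
      intro a h hh
      refine (meanOscillation_improve hmono hconc hzero hnonneg hright hleft hinv_nonneg hf hK hc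
        (by positivity) ih a hh).trans (le_of_eq ?_)
      congr 2
      rw [hD, pow_succ]
      ring
  have hlim : Tendsto (fun k : ℕ => ENNReal.ofReal (D + C * (1 / 4) ^ k) *
      volume (halfOpenCube a h)) atTop (𝓝 (ENNReal.ofReal D * volume (halfOpenCube a h))) := by
    refine ENNReal.Tendsto.mul_const (ENNReal.tendsto_ofReal ?_)
      (Or.inr (volume_halfOpenCube_ne_top a h))
    simpa using ((tendsto_pow_atTop_nhds_zero_of_lt_one (r := (1 / 4 : ℝ)) (by norm_num)
      (by norm_num)).const_mul C).const_add D
  exact ge_of_tendsto' hlim fun k => hiter k a h hh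

theorem abs_clamp_sub_clamp_le (N s t : ℝ) :
    |max (-N) (min N s) - max (-N) (min N t)| ≤ |s - t| := by
  refine (abs_max_sub_max_le_max _ _ _ _).trans ?_
  rw [sub_self, abs_zero, max_eq_right (abs_nonneg _)]
  refine (abs_min_sub_min_le_max _ _ _ _).trans ?_
  rw [sub_self, abs_zero, max_eq_right (abs_nonneg _)]

theorem clamp_eq_self {N t : ℝ} (h : |t| ≤ N) : max (-N) (min N t) = t := by
  rw [abs_le] at h
  rw [min_eq_right h.2, max_eq_right h.1]

theorem abs_clamp_le {N : ℝ} (hN : 0 ≤ N) (t : ℝ) : |max (-N) (min N t)| ≤ N :=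
  abs_le.2 ⟨le_max_left _ _, max_le (by linarith) (min_le_left _ _)⟩

/-- The mean oscillation bound on half-open cubes, without any a priori bound. -/
theorem meanOscillation_le (hmono : MonotoneOn φ (Ici 0))
    (hconc : ConcaveOn ℝ (Ici 0) φ) (hzero : φ 0 = 0) (hnonneg : ∀ t, 0 ≤ t → 0 ≤ φ t)
    (hright : ∀ s, 0 ≤ s → φ (φinv s) = s) (hleft : ∀ t, 0 ≤ t → φinv (φ t) = t)
    (hinv_nonneg : ∀ s, 0 ≤ s → 0 ≤ φinv s) (hf : Measurable f) (hK : 0 < K)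
    {c : (Fin n → ℝ) → ℝ → ℝ}
    (hc : ∀ a h, 0 < h → ∫⁻ x in halfOpenCube a h, ENNReal.ofReal (φ (|f x - c a h| / K)) ≤
      volume (halfOpenCube a h))
    (a : Fin n → ℝ) {h : ℝ} (hh : 0 < h) :
    ∫⁻ x in halfOpenCube a h, ENNReal.ofReal |f x - c a h| ≤
      ENNReal.ofReal ((4 * φinv 4 + φinv (1 + 4 * 2 ^ n)) / 3 * K) *
        volume (halfOpenCube a h) := by
  let clamp : ℕ → ℝ → ℝ := fun N t => max (-N) (min N t)
  have hfm : ∀ N, Measurable fun x => clamp N (f x) := fun N =>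
    measurable_const.max (measurable_const.min hf)
  have hbound : ∀ N : ℕ, ∫⁻ x in halfOpenCube a h,
      ENNReal.ofReal |clamp N (f x) - clamp N (c a h)| ≤
      ENNReal.ofReal ((4 * φinv 4 + φinv (1 + 4 * 2 ^ n)) / 3 * K) *
        volume (halfOpenCube a h) := by
    intro N
    refine meanOscillation_le_of_bounded hmono hconc hzero hnonneg hright hleft hinv_nonneg
      (hfm N) hK (c := fun a h => clamp N (c a h)) (C := 2 * N) (fun a h hh => ?_)
      (by positivity) (fun a h hh => ?_) a hh
    · refine (lintegral_mono fun x => ENNReal.ofReal_le_ofReal (hmono ?_ ?_ ?_)).trans (hc a h hh)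
      · exact mem_Ici.2 (by positivity)
      · exact mem_Ici.2 (by positivity)
      · exact div_le_div_of_nonneg_right (abs_clamp_sub_clamp_le _ _ _) hK.le
    · rw [← setLIntegral_const]
      refine lintegral_mono fun x => ENNReal.ofReal_le_ofReal ?_
      have h1 := abs_clamp_le (Nat.cast_nonneg N) (f x)
      have h2 := abs_clamp_le (Nat.cast_nonneg N) (c a h)
      have h3 := abs_sub (clamp N (f x)) (clamp N (c a h))
      linarith
  have hev : ∀ t : ℝ, ∀ᶠ N : ℕ in atTop, clamp N t = t := fun t => by
    filter_upwards [tendsto_natCast_atTop_atTop.eventually_ge_atTop |t|] with N hN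
    exact clamp_eq_self hN
  calc ∫⁻ x in halfOpenCube a h, ENNReal.ofReal |f x - c a h|
      = ∫⁻ x in halfOpenCube a h,
          liminf (fun N => ENNReal.ofReal |clamp N (f x) - clamp N (c a h)|) atTop := by
        refine lintegral_congr fun x => (Tendsto.liminf_eq ?_).symm
        refine tendsto_const_nhds.congr' ?_
        filter_upwards [hev (f x), hev (c a h)] with N h1 h2
        rw [h1, h2]
    _ ≤ liminf (fun N => ∫⁻ x in halfOpenCube a h,
          ENNReal.ofReal |clamp N (f x) - clamp N (c a h)|) atTop :=
        lintegral_liminf_le fun N => ((hfm N).sub_const _).abs.ennreal_ofReal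
    _ ≤ _ := liminf_le_of_le (by isBoundedDefault) fun b hb => by
        obtain ⟨N, hN⟩ := hb.exists
        exact hN.trans (hbound N)

end Oscillation

/-- Theorem 1.1 of the paper: if `φ : [0,∞) → [0,∞)` is increasing, concave, `φ(0)=0`,
`φ(t) → ∞`, and a measurable `f` satisfies `⨍_Q φ(|f - c_Q|/K) ≤ 1` for every cube `Q`
(for some constant `c_Q`), then `f` is locally integrable and
`⨍_Q |f - c| ≤ (2 φ⁻¹(4) + φ⁻¹(2 + 2^{n+2}))·K` for some constant `c`, for every cube `Q`. -/
theorem bmo_phi_implies_bmo (n : ℕ) (φ φinv : ℝ → ℝ)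
    (hmono : MonotoneOn φ (Set.Ici 0))
    (hconc : ConcaveOn ℝ (Set.Ici 0) φ)
    (hzero : φ 0 = 0)
    (htop : Tendsto φ atTop atTop)
    (hnonneg : ∀ t, 0 ≤ t → 0 ≤ φ t)
    (hinv_right : ∀ s, 0 ≤ s → φ (φinv s) = s)
    (hinv_left : ∀ t, 0 ≤ t → φinv (φ t) = t)
    (hinv_nonneg : ∀ s, 0 ≤ s → 0 ≤ φinv s)
    (f : (Fin n → ℝ) → ℝ) (hf : Measurable f)
    (K : ℝ) (hK : 0 < K)
    (hyp : ∀ Q : Set (Fin n → ℝ), IsCube n Q → ∃ c : ℝ,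
      ∫⁻ x in Q, ENNReal.ofReal (φ (|f x - c| / K)) ≤ volume Q) :
    LocallyIntegrable f volume ∧
    ∀ Q : Set (Fin n → ℝ), IsCube n Q → ∃ c : ℝ,
      ∫⁻ x in Q, ENNReal.ofReal |f x - c|
        ≤ ENNReal.ofReal ((2 * φinv 4 + φinv (2 + 2 ^ (n + 2))) * K) * volume Q := by
  have hcube : ∀ (a : Fin n → ℝ) (h : ℝ), ∃ c : ℝ, 0 < h →
      ∫⁻ x in halfOpenCube a h, ENNReal.ofReal (φ (|f x - c| / K)) ≤
        volume (halfOpenCube a h) := by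
    intro a h
    by_cases hh : 0 < h
    · obtain ⟨c, hc⟩ := hyp _ ⟨a, h, hh, rfl⟩
      refine ⟨c, fun _ => ?_⟩
      rwa [setLIntegral_congr (halfOpenCube_ae_eq a h), measure_congr (halfOpenCube_ae_eq a h)]
    · exact ⟨0, fun h0 => absurd h0 hh⟩
  choose c hc using hcube
  have h4 := hinv_nonneg 4 (by norm_num)
  have hle : φinv (1 + 4 * 2 ^ n) ≤ φinv (2 + 2 ^ (n + 2)) := by
    refine le_inv_of_le hmono hinv_right hinv_left hinv_nonneg (by positivity)
      (hinv_nonneg _ (by positivity)) ?_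
    rw [hinv_right _ (by positivity), pow_add]
    linarith
  have h0 := hinv_nonneg (1 + 4 * 2 ^ n) (by positivity)
  have main : ∀ Q : Set (Fin n → ℝ), IsCube n Q → ∃ c : ℝ,
      ∫⁻ x in Q, ENNReal.ofReal |f x - c|
        ≤ ENNReal.ofReal ((2 * φinv 4 + φinv (2 + 2 ^ (n + 2))) * K) * volume Q := by
    rintro _ ⟨a, h, hh, rfl⟩
    refine ⟨c a h, ?_⟩
    rw [← setLIntegral_congr (halfOpenCube_ae_eq a h), ← measure_congr (halfOpenCube_ae_eq a h)]
    refine (meanOscillation_le hmono hconc hzero hnonneg hinv_right hinv_left hinv_nonneg hf hK hc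
      a hh).trans ?_
    gcongr
    linarith
  refine ⟨fun x => ?_, main⟩
  have hball : Metric.closedBall x 1 = univ.pi fun i => Icc (x i - 1) (x i - 1 + 2) := by
    rw [closedBall_pi _ zero_le_one]
    refine Set.pi_congr rfl fun i _ => ?_
    rw [Real.closedBall_eq_Icc]
    congr 1
    ring
  obtain ⟨d, hd⟩ := main _ ⟨fun i => x i - 1, 2, two_pos, hball⟩
  refine ⟨Metric.closedBall x 1, Metric.closedBall_mem_nhds x one_pos, ?_⟩
  have hfin : volume (Metric.closedBall x 1) ≠ ∞ := measure_closedBall_lt_top.ne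
  have hint : IntegrableOn (fun y => f y - d) (Metric.closedBall x 1) := by
    refine ⟨(hf.sub_const d).aestronglyMeasurable, ?_⟩
    rw [hasFiniteIntegral_iff_norm]
    exact hd.trans_lt (ENNReal.mul_lt_top ENNReal.ofReal_lt_top hfin.lt_top)
  refine (hint.add (integrableOn_const (C := d) hfin)).congr (Eventually.of_forall fun y => ?_)
  simp
end

section
/- (Riesz's Rising Sun lemma, non-doubling version) Let μ be a Borel measure on ℝ^n with μ(∂P) = 0 for every axis-parallel rectangle P, let R be an axis-parallel rectangle with 0 < μ(R) < ∞, let h ∈ L¹(R, μ) be real-valued, and let λ > ⨍_R h dμ. Then there exists an at most countable family of pairwise disjoint axis-parallel rectangles {R_j} with R_j ⊂ R such that ⨍_{R_j} h dμ = λ for each j and h(x) ≤ λ for μ-almost every x ∈ R \ ⋃_j R_j. Moreover, if h ≥ 0, then ∑_j μ(R_j) ≤ (μ(R)/λ) ⨍_R h dμ. -/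
open MeasureTheory Set Filter

/-- An axis-parallel rectangle (a product of bounded intervals of positive length) in `ℝⁿ`. -/
def IsRect (n : ℕ) (R : Set (Fin n → ℝ)) : Prop :=
  ∃ a b : Fin n → ℝ, (∀ i, a i < b i) ∧ R = Set.univ.pi fun i => Set.Icc (a i) (b i)

/-- The running maximum from the right of a continuous function, truncated at its initial value. -/
theorem exists_antitone_majorant {Φ : ℝ → ℝ} (hΦ : Continuous Φ) {α β : ℝ} (hαβ : α < β)
    (hlt : Φ β < Φ α) :
    ∃ m : ℝ → ℝ, Continuous m ∧ AntitoneOn m (Icc α β) ∧ m α = Φ α ∧ m β = Φ β ∧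
      (∀ t ∈ Icc α β, ∀ t' ∈ Icc t β, min (Φ t') (Φ α) ≤ m t) ∧
      ∀ t ∈ Icc α β, ∃ t' ∈ Icc t β, min (Φ t') (Φ α) = m t := by
  set Ψ : ℝ → ℝ := fun t => min (Φ t) (Φ α)
  have hΨ : Continuous Ψ := hΦ.min continuous_const
  set m : ℝ → ℝ := fun t => sSup ((fun s => Ψ (max s t)) '' Icc α β)
  have hc : ∀ t, Continuous fun s => Ψ (max s t) := fun t =>
    hΨ.comp (continuous_id.max continuous_const)
  have hm : Continuous m := by
    refine isCompact_Icc.continuous_sSup (f := fun t s => Ψ (max s t)) ?_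
    exact hΨ.comp (continuous_snd.max continuous_fst)
  have hle : ∀ t ∈ Icc α β, ∀ t' ∈ Icc t β, Ψ t' ≤ m t := by
    intro t ht t' ht'
    refine le_csSup (isCompact_Icc.image (hc t)).bddAbove
      ⟨t', ⟨ht.1.trans ht'.1, ht'.2⟩, ?_⟩
    simp [max_eq_left ht'.1]
  have hatt : ∀ t ∈ Icc α β, ∃ t' ∈ Icc t β, Ψ t' = m t := by
    intro t ht
    obtain ⟨s, hs, h⟩ := isCompact_Icc.exists_sSup_image_eq (nonempty_Icc.2 hαβ.le)
      (hc t).continuousOn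
    exact ⟨max s t, ⟨le_max_right _ _, max_le hs.2 ht.2⟩, h.symm⟩
  refine ⟨m, hm, ?_, ?_, ?_, hle, hatt⟩
  · intro x hx y hy hxy
    obtain ⟨t', ht', h⟩ := hatt y hy
    rw [← h]
    exact hle x hx t' ⟨hxy.trans ht'.1, ht'.2⟩
  · have hα : α ∈ Icc α β := left_mem_Icc.2 hαβ.le
    obtain ⟨t', ht', h⟩ := hatt α hα
    refine le_antisymm (h ▸ min_le_right _ _) ?_
    simpa [Ψ] using hle α hα α hα
  · have hβ : β ∈ Icc α β := right_mem_Icc.2 hαβ.le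
    obtain ⟨t', ht', h⟩ := hatt β hβ
    have : t' = β := le_antisymm ht'.2 ht'.1
    rw [← h, this]
    exact min_eq_left hlt.le

/-- Preimages of level intervals under the running maximum are closed intervals across which
the original function has the corresponding decrement. -/
theorem exists_level_function {Φ : ℝ → ℝ} (hΦ : Continuous Φ) {α β : ℝ} (hαβ : α < β)
    (hlt : Φ β < Φ α) :
    ∃ m : ℝ → ℝ, Continuous m ∧ AntitoneOn m (Icc α β) ∧
      (∀ t ∈ Icc α β, m t ∈ Icc (Φ β) (Φ α)) ∧
      ∀ s₁ s₂, Φ β ≤ s₁ → s₁ ≤ s₂ → s₂ ≤ Φ α → ∃ u v, α ≤ u ∧ u ≤ v ∧ v ≤ β ∧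
        Icc α β ∩ m ⁻¹' Icc s₁ s₂ = Icc u v ∧ Φ u = s₂ ∧ Φ v = s₁ := by
  obtain ⟨m, hm, hanti, hmα, hmβ, hle, hatt⟩ := exists_antitone_majorant hΦ hαβ hlt
  have hα : α ∈ Icc α β := left_mem_Icc.2 hαβ.le
  have hβ : β ∈ Icc α β := right_mem_Icc.2 hαβ.le
  refine ⟨m, hm, hanti, fun t ht => ⟨hmβ ▸ hanti ht hβ ht.2, hmα ▸ hanti hα ht ht.1⟩, ?_⟩
  intro s₁ s₂ h₁ h₁₂ h₂
  set A := Icc α β ∩ m ⁻¹' Icc s₁ s₂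
  have hivt : Icc (Φ β) (Φ α) ⊆ m '' Icc α β := by
    rw [← hmα, ← hmβ]
    exact intermediate_value_Icc' hαβ.le hm.continuousOn
  obtain ⟨t₁, ht₁, hmt₁⟩ := hivt ⟨h₁, h₁₂.trans h₂⟩
  obtain ⟨t₂, ht₂, hmt₂⟩ := hivt ⟨h₁.trans h₁₂, h₂⟩
  have hA₁ : t₁ ∈ A := ⟨ht₁, by simp [hmt₁, h₁₂]⟩
  have hA₂ : t₂ ∈ A := ⟨ht₂, by simp [hmt₂, h₁₂]⟩
  have hAc : IsCompact A := isCompact_Icc.inter_right (isClosed_Icc.preimage hm)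
  obtain ⟨v, hv, hvmax⟩ := hAc.exists_isGreatest ⟨_, hA₁⟩
  obtain ⟨u, hu, humin⟩ := hAc.exists_isLeast ⟨_, hA₁⟩
  have hmv : m v = s₁ :=
    le_antisymm (hmt₁ ▸ hanti ht₁ hv.1 (hvmax hA₁)) hv.2.1
  have hmu : m u = s₂ :=
    le_antisymm hu.2.2 (hmt₂ ▸ hanti hu.1 ht₂ (humin hA₂))
  refine ⟨u, v, hu.1.1, humin hv, hv.1.2, ?_, ?_, ?_⟩
  · ext t
    refine ⟨fun ht => ⟨humin ht, hvmax ht⟩, fun ht => ?_⟩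
    have htm : t ∈ Icc α β := ⟨hu.1.1.trans ht.1, ht.2.trans hv.1.2⟩
    exact ⟨htm, hmv ▸ hanti htm hv.1 ht.2, hmu ▸ hanti hu.1 htm ht.1⟩
  · rcases hu.1.1.eq_or_lt with rfl | hlt'
    · rw [← hmα, hmu]
    have key : ∀ t ∈ Ico α u, s₂ < m t := by
      intro t ht
      have htm : t ∈ Icc α β := ⟨ht.1, ht.2.le.trans hu.1.2⟩
      have hge : s₂ ≤ m t := hmu ▸ hanti htm hu.1 ht.2.le
      by_contra hcon
      exact absurd (humin (show t ∈ A from ⟨htm, h₁₂.trans hge, not_lt.1 hcon⟩))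
        (not_le.2 ht.2)
    have hs₂ : s₂ < Φ α := hmα ▸ key α ⟨le_rfl, hlt'⟩
    apply le_antisymm
    · have := hle u hu.1 u ⟨le_rfl, hu.1.2⟩
      rw [hmu] at this
      rcases min_le_iff.1 this with h | h
      · exact h
      · exact absurd h (not_le.2 hs₂)
    · by_contra hcon
      obtain ⟨l, hl, hlu⟩ := exists_Ioc_subset_of_mem_nhds
        (hΦ.continuousAt.eventually_lt continuousAt_const (not_le.1 hcon)) ⟨α, hlt'⟩
      obtain ⟨t, ht, htu⟩ := exists_between (max_lt hl hlt')
      have hαt : α ≤ t := ((le_max_right _ _).trans_lt ht).le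
      have htm : t ∈ Icc α β := ⟨hαt, htu.le.trans hu.1.2⟩
      obtain ⟨t', ht', hatt'⟩ := hatt t htm
      have h1 := key t ⟨hαt, htu⟩
      rw [← hatt'] at h1
      have h2 := (lt_min_iff.1 h1).1
      rcases le_or_gt t' u with h3 | h3
      · exact absurd (hlu ⟨((le_max_left _ _).trans_lt ht).trans_le ht'.1, h3⟩ : Φ t' < s₂)
          (not_lt.2 h2.le)
      · have := hle u hu.1 t' ⟨h3.le, ht'.2⟩
        rw [hmu] at this
        exact absurd this (not_le.2 h1)
  · apply le_antisymm
    · rcases hv.1.2.eq_or_lt with rfl | hvβ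
      · exact h₁
      by_contra hcon
      obtain ⟨l, hl, hlv⟩ := exists_Ico_subset_of_mem_nhds
        (continuousAt_const.eventually_lt hΦ.continuousAt (not_le.1 hcon)) ⟨β, hvβ⟩
      obtain ⟨t, hvt, ht⟩ := exists_between (lt_min hl hvβ)
      have htm : t ∈ Icc α β := ⟨hv.1.1.trans hvt.le, (ht.trans_le (min_le_right _ _)).le⟩
      have h1 : s₁ < Φ t := hlv ⟨hvt.le, ht.trans_le (min_le_left _ _)⟩
      have h2 := hle t htm t ⟨le_rfl, htm.2⟩
      have h3 : s₁ ≤ m t := (le_min h1.le (h₁₂.trans h₂)).trans h2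
      have h4 : m t ≤ s₁ := hmv ▸ hanti hv.1 htm hvt.le
      exact absurd (hvmax (show t ∈ A from ⟨htm, h3, h4.trans h₁₂⟩)) (not_le.2 hvt)
    · obtain ⟨t', ht', h⟩ := hatt v hv.1
      have htm : t' ∈ Icc α β := ⟨hv.1.1.trans ht'.1, ht'.2⟩
      have h1 := hle t' htm t' ⟨le_rfl, htm.2⟩
      rw [h, hmv] at h1
      have h2 : m t' ≤ s₁ := hmv ▸ hanti hv.1 htm ht'.1
      have h3 : t' = v :=
        le_antisymm (hvmax (show t' ∈ A from ⟨htm, h1, h2.trans h₁₂⟩)) ht'.1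
      rw [← hmv, ← h, h3]
      exact min_le_left _ _

/-- A closed interval across which `Φ` decreases is covered, up to a `ν`-null set, by countably
many disjoint closed intervals across which `Φ` either is balanced or decreases, the latter
being short. -/
theorem exists_interval_decomposition {Φ : ℝ → ℝ} (hΦ : Continuous Φ) {α β : ℝ} (hαβ : α < β)
    (hlt : Φ β < Φ α) (ν : Measure ℝ) [IsFiniteMeasure ν] {δ : ℝ} (hδ : 0 < δ) :
    ∃ (J : Set ℝ) (u v : ℝ → ℝ), J.Countable ∧ J.PairwiseDisjoint (fun s => Icc (u s) (v s)) ∧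
      (∀ s ∈ J, α ≤ u s ∧ u s < v s ∧ v s ≤ β ∧
        ((Φ (v s) = Φ (u s) ∧ 0 < ν (Icc (u s) (v s))) ∨
          (Φ (v s) < Φ (u s) ∧ v s - u s < δ))) ∧
      ν (Icc α β \ ⋃ s ∈ J, Icc (u s) (v s)) = 0 := by
  classical
  obtain ⟨m, hm, hanti, hrange, hlev⟩ := exists_level_function hΦ hαβ hlt
  have hpre : ∀ s r : ℝ, ∃ u v : ℝ, s ∈ Icc (Φ β) (Φ α) → 0 ≤ r → α ≤ u ∧ u ≤ v ∧ v ≤ β ∧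
      Icc α β ∩ m ⁻¹' Metric.closedBall s r = Icc u v ∧ (r = 0 → Φ v = Φ u) ∧
      (0 < r → Φ v < Φ u) := by
    intro s r
    by_cases hsr : s ∈ Icc (Φ β) (Φ α) ∧ 0 ≤ r
    · obtain ⟨⟨hs1, hs2⟩, hr⟩ := hsr
      obtain ⟨u, v, h1, h2, h3, h4, h5, h6⟩ := hlev (max (s - r) (Φ β)) (min (s + r) (Φ α))
        (le_max_right _ _) (max_le (le_min (by linarith) (by linarith)) (le_min (by linarith) hlt.le))
        (min_le_right _ _)
      refine ⟨u, v, fun _ _ => ⟨h1, h2, h3, ?_, ?_, ?_⟩⟩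
      · rw [← h4, Real.closedBall_eq_Icc]
        ext t
        constructor
        · rintro ⟨ht, ht1, ht2⟩
          exact ⟨ht, max_le ht1 (hrange t ht).1, le_min ht2 (hrange t ht).2⟩
        · rintro ⟨ht, ht1, ht2⟩
          exact ⟨ht, (le_max_left _ _).trans ht1, ht2.trans (min_le_left _ _)⟩
      · rintro rfl
        rw [h5, h6]
        simp [hs1, hs2]
      · intro hr'
        rw [h5, h6]
        refine max_lt (lt_min (by linarith) (by linarith)) (lt_min (by linarith) hlt)
    · exact ⟨0, 0, fun h1 h2 => absurd ⟨h1, h2⟩ hsr⟩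
  choose u v huv using hpre
  set L := Icc (Φ β) (Φ α)
  have hmono : ∀ s ∈ L, ∀ s' ∈ L, ∀ r r' : ℝ, 0 ≤ r → 0 ≤ r' →
      Metric.closedBall s r ⊆ Metric.closedBall s' r' → v s r - u s r ≤ v s' r' - u s' r' := by
    intro s hs s' hs' r r' hr hr' hsub
    obtain ⟨-, h2, -, h4, -⟩ := huv s r hs hr
    obtain ⟨-, h2', -, h4', -⟩ := huv s' r' hs' hr'
    have : Icc (u s r) (v s r) ⊆ Icc (u s' r') (v s' r') := by
      rw [← h4, ← h4']
      exact inter_subset_inter_right _ (preimage_mono hsub)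
    have := (Icc_subset_Icc_iff h2).1 this
    linarith [this.1, this.2]
  set bad : Set ℝ := {s | s ∈ L ∧ δ ≤ v s 0 - u s 0}
  have hgood : ∀ s ∈ L \ bad, ∃ r > 0, v s r - u s r < δ := by
    rintro s ⟨hs, hsb⟩
    have hsb : v s 0 - u s 0 < δ := not_le.1 fun h => hsb ⟨hs, h⟩
    obtain ⟨h1, h2, h3, h4, -⟩ := huv s 0 hs le_rfl
    set η := (δ - (v s 0 - u s 0)) / 3 with hη
    have hη0 : 0 < η := by simp only [hη]; linarith
    have hmu : m (u s 0) = s := by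
      have : u s 0 ∈ Icc (u s 0) (v s 0) := left_mem_Icc.2 h2
      rw [← h4] at this
      simpa using this.2
    have hmv : m (v s 0) = s := by
      have : v s 0 ∈ Icc (u s 0) (v s 0) := right_mem_Icc.2 h2
      rw [← h4] at this
      simpa using this.2
    have hnot : ∀ t ∈ Icc α β, t ∉ Icc (u s 0) (v s 0) → m t ≠ s := by
      intro t ht htn hmt
      rw [← h4] at htn
      exact htn ⟨ht, by simp [hmt]⟩
    have hleft : ∃ r > 0, ∀ t ∈ Icc α β, t ≤ u s 0 - η → s + r < m t := by
      by_cases hc : α ≤ u s 0 - η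
      · have hx : u s 0 - η ∈ Icc α β := ⟨hc, by linarith⟩
        have h5 : s < m (u s 0 - η) :=
          lt_of_le_of_ne (hmu.ge.trans (hanti hx ⟨h1, h2.trans h3⟩ (by linarith)))
            (hnot _ hx fun h => by linarith [h.1]).symm
        refine ⟨(m (u s 0 - η) - s) / 2, by linarith, fun t ht htle => ?_⟩
        linarith [hanti ht hx htle]
      · exact ⟨1, one_pos, fun t ht htle => absurd (ht.1.trans htle) hc⟩
    have hright : ∃ r > 0, ∀ t ∈ Icc α β, v s 0 + η ≤ t → m t < s - r := by
      by_cases hc : v s 0 + η ≤ β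
      · have hx : v s 0 + η ∈ Icc α β := ⟨by linarith, hc⟩
        have h5 : m (v s 0 + η) < s :=
          lt_of_le_of_ne ((hanti ⟨h1.trans h2, h3⟩ hx (by linarith)).trans hmv.le)
            (hnot _ hx fun h => by linarith [h.2])
        refine ⟨(s - m (v s 0 + η)) / 2, by linarith, fun t ht htle => ?_⟩
        linarith [hanti hx ht htle]
      · exact ⟨1, one_pos, fun t ht htle => absurd (htle.trans ht.2) hc⟩
    obtain ⟨r₁, hr₁, hl⟩ := hleft
    obtain ⟨r₂, hr₂, hr⟩ := hright
    have hr0 : 0 < min r₁ r₂ := lt_min hr₁ hr₂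
    refine ⟨min r₁ r₂, hr0, ?_⟩
    obtain ⟨k1, k2, k3, k4, -⟩ := huv s (min r₁ r₂) hs hr0.le
    have hU : u s (min r₁ r₂) ∈ Icc α β ∩ m ⁻¹' Metric.closedBall s (min r₁ r₂) := by
      rw [k4]; exact left_mem_Icc.2 k2
    have hV : v s (min r₁ r₂) ∈ Icc α β ∩ m ⁻¹' Metric.closedBall s (min r₁ r₂) := by
      rw [k4]; exact right_mem_Icc.2 k2
    rw [Real.closedBall_eq_Icc] at hU hV
    have hU' : u s 0 - η < u s (min r₁ r₂) := by
      by_contra hcon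
      have := hl _ hU.1 (not_lt.1 hcon)
      have h6 := hU.2.2
      linarith [min_le_left r₁ r₂]
    have hV' : v s (min r₁ r₂) < v s 0 + η := by
      by_contra hcon
      have := hr _ hV.1 (not_lt.1 hcon)
      have h6 := hV.2.1
      linarith [min_le_right r₁ r₂]
    linarith
  have hbadc : bad.Countable := by
    refine PairwiseDisjoint.countable_of_nonempty_interior
      (s := fun s => Icc (u s 0) (v s 0)) ?_ ?_
    · intro s hs s' hs' hne
      rw [Function.onFun, Set.disjoint_left]
      intro t ht ht'
      rw [← (huv s 0 hs.1 le_rfl).2.2.2.1] at ht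
      rw [← (huv s' 0 hs'.1 le_rfl).2.2.2.1] at ht'
      have h1 : m t = s := by simpa using ht.2
      have h2 : m t = s' := by simpa using ht'.2
      exact hne (h1.symm.trans h2)
    · intro s hs
      rw [interior_Icc, nonempty_Ioo]
      have := hs.2
      linarith
  obtain ⟨t, r, htc, hts, htr, htnull, htd⟩ :=
    Besicovitch.exists_disjoint_closedBall_covering_ae ((ν.restrict (Icc α β)).map m)
      (fun s => {r | 0 < r ∧ v s r - u s r < δ}) (L \ bad) (by
        intro s hs ε hε
        obtain ⟨r, hr, hlt⟩ := hgood s hs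
        have h0 : 0 < min r (ε / 2) := lt_min hr (by linarith)
        exact ⟨min r (ε / 2), ⟨h0, (hmono s hs.1 s hs.1 _ _ h0.le hr.le
          (Metric.closedBall_subset_closedBall (min_le_left _ _))).trans_lt hlt⟩, h0,
          (min_le_right _ _).trans_lt (by linarith)⟩) (fun _ => 1) (fun _ _ => one_pos)
  set bad' : Set ℝ := {s | s ∈ bad ∧ 0 < ν (Icc (u s 0) (v s 0))}
  set ρ : ℝ → ℝ := fun s => if s ∈ t then r s else 0
  have hρt : ∀ s ∈ t, ρ s = r s := fun s hs => if_pos hs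
  have hρb : ∀ s ∈ bad, ρ s = 0 := fun s hs => if_neg fun h => (hts h).2 hs
  have hρ0 : ∀ s, 0 ≤ ρ s := by
    intro s
    by_cases hs : s ∈ t
    · rw [hρt s hs]; exact (htr s hs).1.1.le
    · simp [ρ, hs]
  have hJL : ∀ s ∈ t ∪ bad', s ∈ L := by
    rintro s (hs | hs)
    exacts [(hts hs).1, hs.1.1]
  have hsep : ∀ s ∈ t, ∀ s' ∈ bad, s' ∉ Metric.closedBall s (r s) := by
    intro s hs s' hs' hmem
    have h1 := hmono s' hs'.1 s (hts hs).1 0 (r s) le_rfl (htr s hs).1.1.le (by simpa using hmem)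
    have h2 := hs'.2
    have h3 := (htr s hs).1.2
    linarith
  refine ⟨t ∪ bad', fun s => u s (ρ s), fun s => v s (ρ s),
    htc.union (hbadc.mono fun s hs => hs.1), ?_, ?_, ?_⟩
  · have hballs : (t ∪ bad').PairwiseDisjoint fun s => Metric.closedBall s (ρ s) := by
      rintro s (hs | hs) s' (hs' | hs') hne
      · simpa only [Function.onFun, hρt s hs, hρt s' hs'] using htd hs hs' hne
      · simp only [Function.onFun, hρt s hs, hρb s' hs'.1, Metric.closedBall_zero]
        exact disjoint_singleton_right.2 (hsep s hs s' hs'.1)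
      · simp only [Function.onFun, hρt s' hs', hρb s hs.1, Metric.closedBall_zero]
        exact disjoint_singleton_left.2 (hsep s' hs' s hs.1)
      · simp only [Function.onFun, hρb s hs.1, hρb s' hs'.1, Metric.closedBall_zero]
        simpa using hne
    intro s hs s' hs' hne
    simp only [Function.onFun]
    rw [← (huv s (ρ s) (hJL s hs) (hρ0 s)).2.2.2.1, ← (huv s' (ρ s') (hJL s' hs') (hρ0 s')).2.2.2.1]
    exact ((hballs hs hs' hne).preimage m).mono inter_subset_right inter_subset_right
  · intro s hs
    obtain ⟨h1, h2, h3, -, h5, h6⟩ := huv s (ρ s) (hJL s hs) (hρ0 s)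
    have key : u s (ρ s) < v s (ρ s) ∧ ((Φ (v s (ρ s)) = Φ (u s (ρ s)) ∧
        0 < ν (Icc (u s (ρ s)) (v s (ρ s)))) ∨
          (Φ (v s (ρ s)) < Φ (u s (ρ s)) ∧ v s (ρ s) - u s (ρ s) < δ)) := by
      rcases hs with hs | hs
      · have hr := (htr s hs).1
        have hΦlt := h6 (by rw [hρt s hs]; exact hr.1)
        refine ⟨lt_of_le_of_ne h2 fun h => ?_, Or.inr ⟨hΦlt, by rw [hρt s hs]; exact hr.2⟩⟩
        rw [h] at hΦlt
        exact lt_irrefl _ hΦlt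
      · have h0 := hρb s hs.1
        refine ⟨?_, Or.inl ⟨h5 h0, by rw [h0]; exact hs.2⟩⟩
        rw [h0]
        linarith [hs.1.2]
    exact ⟨h1, key.1, h3, key.2⟩
  · have hnull₁ : ν (Icc α β ∩ m ⁻¹' ((L \ bad) \ ⋃ s ∈ t, Metric.closedBall s (r s))) = 0 := by
      have := (Measure.tendsto_ae_map hm.aemeasurable).eventually (compl_mem_ae_iff.2 htnull)
      rw [Filter.eventually_iff, mem_ae_iff] at this
      rw [Measure.restrict_apply' measurableSet_Icc] at this
      convert this using 2
      ext x
      simp [and_comm, and_assoc]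
    have hnull₂ : ν (⋃ s ∈ bad \ bad', Icc (u s 0) (v s 0)) = 0 := by
      rw [measure_biUnion_null_iff (hbadc.mono sdiff_subset)]
      intro s hs
      exact nonpos_iff_eq_zero.1 (not_lt.1 fun h => hs.2 ⟨hs.1, h⟩)
    refine measure_mono_null ?_ (measure_union_null hnull₁ hnull₂)
    rintro x ⟨hx, hxn⟩
    simp only [mem_iUnion, not_exists] at hxn
    by_cases hb : m x ∈ bad
    · have hx0 : x ∈ Icc (u (m x) 0) (v (m x) 0) := by
        rw [← (huv _ 0 hb.1 le_rfl).2.2.2.1]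
        exact ⟨hx, by simp⟩
      refine Or.inr (mem_biUnion (x := m x) ⟨hb, fun h => hxn (m x) (Or.inr h) ?_⟩ hx0)
      rw [hρb _ hb]
      exact hx0
    · refine Or.inl ⟨hx, ⟨hrange x hx, hb⟩, fun hmem => ?_⟩
      obtain ⟨s, hs, hxs⟩ := mem_iUnion₂.1 hmem
      refine hxn s (Or.inl hs) ?_
      rw [hρt s hs, ← (huv s (r s) (hts hs).1 (htr s hs).1.1.le).2.2.2.1]
      exact ⟨hx, hxs⟩

theorem IsRect.measurableSet {n : ℕ} {B : Set (Fin n → ℝ)} (hB : IsRect n B) :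
    MeasurableSet B := by
  obtain ⟨a, b, -, rfl⟩ := hB
  exact MeasurableSet.univ_pi fun _ => measurableSet_Icc

theorem IsRect.slab {n : ℕ} {a b : Fin n → ℝ} (hab : ∀ i, a i < b i) (i : Fin n) {u v : ℝ}
    (hau : a i ≤ u) (huv : u < v) (hvb : v ≤ b i) :
    IsRect n ((univ.pi fun j => Icc (a j) (b j)) ∩ {x | x i ∈ Icc u v}) := by
  refine ⟨Function.update a i u, Function.update b i v, fun j => ?_, ?_⟩
  · rcases eq_or_ne j i with rfl | hj
    · simpa using huv
    · simpa [hj] using hab j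
  · ext x
    simp only [mem_inter_iff, mem_univ_pi, mem_ofPred_eq]
    constructor
    · rintro ⟨h, hi⟩ j
      rcases eq_or_ne j i with rfl | hj
      · simpa using hi
      · simpa [hj] using h j
    · intro h
      have hi : x i ∈ Icc u v := by simpa using h i
      refine ⟨fun j => ?_, hi⟩
      rcases eq_or_ne j i with rfl | hj
      · exact ⟨hau.trans hi.1, hi.2.trans hvb⟩
      · simpa [hj] using h j

theorem IsRect.measure_slice_eq_zero {n : ℕ} {μ : Measure (Fin n → ℝ)}
    (hμ : ∀ P : Set (Fin n → ℝ), IsRect n P → μ (frontier P) = 0)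
    {a b : Fin n → ℝ} (hab : ∀ i, a i < b i) (i : Fin n) (t : ℝ) :
    μ ((univ.pi fun j => Icc (a j) (b j)) ∩ {x | x i = t}) = 0 := by
  set P : Set (Fin n → ℝ) :=
    univ.pi fun j => Icc (Function.update a i t j) (Function.update b i (t + 1) j)
  have hP : IsRect n P := by
    refine ⟨_, _, fun j => ?_, rfl⟩
    rcases eq_or_ne j i with rfl | hj
    · simp
    · simpa [hj] using hab j
  refine measure_mono_null ?_ (hμ P hP)
  rintro x ⟨hx, hxi⟩
  have hxi : x i = t := hxi
  refine ⟨subset_closure fun j _ => ?_, fun hint => ?_⟩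
  · rcases eq_or_ne j i with rfl | hj
    · simp [hxi]
    · simpa [hj] using hx j (mem_univ _)
  · rw [interior_pi_set finite_univ] at hint
    have := hint i (mem_univ _)
    simp [hxi] at this

/-- `T` is a countable family of disjoint rectangles covering `B` up to a null set, each of which
either has positive measure and balanced integral, or negative integral and property `P`. -/
structure IsSunDecomposition {n : ℕ} (μ : Measure (Fin n → ℝ)) (g : (Fin n → ℝ) → ℝ)
    (P : Set (Fin n → ℝ) → Prop) (B : Set (Fin n → ℝ)) (T : Set (Set (Fin n → ℝ))) : Prop where
  countable : T.Countable
  disjoint : T.PairwiseDisjoint id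
  isRect : ∀ r ∈ T, IsRect n r
  subset : ∀ r ∈ T, r ⊆ B
  sign : ∀ r ∈ T, (∫ x in r, g x ∂μ = 0 ∧ 0 < μ r) ∨ (∫ x in r, g x ∂μ < 0 ∧ P r)
  null : μ (B \ ⋃₀ T) = 0

theorem exists_isSunDecomposition_coord {n : ℕ} {μ : Measure (Fin n → ℝ)}
    (hμ : ∀ P : Set (Fin n → ℝ), IsRect n P → μ (frontier P) = 0)
    {g : (Fin n → ℝ) → ℝ} {B : Set (Fin n → ℝ)} (hB : IsRect n B) (hfin : μ B < ⊤)
    (hg : IntegrableOn g B μ) (hneg : ∫ x in B, g x ∂μ < 0) (i : Fin n) {δ : ℝ} (hδ : 0 < δ) :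
    ∃ T, IsSunDecomposition μ g (fun r => ∀ x ∈ r, ∀ y ∈ r, |x i - y i| ≤ δ) B T := by
  have hBm := hB.measurableSet
  obtain ⟨a, b, hab, hBab⟩ := hB
  have hslice : ∀ t, μ (B ∩ {x | x i = t}) = 0 := fun t =>
    hBab ▸ IsRect.measure_slice_eq_zero hμ hab i t
  have hBi : ∀ x ∈ B, x i ∈ Icc (a i) (b i) := by
    rw [hBab]; exact fun x hx => hx i (mem_univ _)
  have hle : ∀ t : ℝ, MeasurableSet {x : Fin n → ℝ | x i ≤ t} := fun t =>
    measurableSet_le (measurable_pi_apply i) measurable_const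
  set Φ : ℝ → ℝ := fun t => ∫ x in B, {x : Fin n → ℝ | x i ≤ t}.indicator g x ∂μ with hΦdef
  have hΦint : ∀ t, Φ t = ∫ x in B ∩ {x | x i ≤ t}, g x ∂μ := fun t => by
    rw [hΦdef]; exact setIntegral_indicator (hle t)
  have hΦ : Continuous Φ := by
    rw [continuous_iff_continuousAt]
    intro t₀
    refine MeasureTheory.continuousAt_of_dominated (bound := fun x => ‖g x‖) ?_ ?_ hg.norm ?_
    · exact Eventually.of_forall fun t => hg.aestronglyMeasurable.indicator (hle t)
    · exact Eventually.of_forall fun t => Eventually.of_forall fun x =>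
        norm_indicator_le_norm_self _ _
    · rw [ae_restrict_iff' hBm]
      have : ∀ᵐ x ∂μ, x ∉ B ∩ {x | x i = t₀} := compl_mem_ae_iff.2 (hslice t₀)
      filter_upwards [this] with x hx hxB
      have hne : x i ≠ t₀ := fun h => hx ⟨hxB, h⟩
      rcases hne.lt_or_gt with h | h
      · refine (continuousAt_const (y := g x)).congr ?_
        filter_upwards [Ioi_mem_nhds h] with t ht
        exact (indicator_of_mem (s := {x : Fin n → ℝ | x i ≤ t}) (le_of_lt (mem_Ioi.1 ht)) g).symm
      · refine (continuousAt_const (y := (0 : ℝ))).congr ?_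
        filter_upwards [Iio_mem_nhds h] with t ht
        exact (indicator_of_notMem (s := {x : Fin n → ℝ | x i ≤ t}) (not_le.2 (mem_Iio.1 ht)) g).symm
  have hΦa : Φ (a i) = 0 := by
    rw [hΦint]
    refine setIntegral_measure_zero _ (measure_mono_null ?_ (hslice (a i)))
    exact fun x hx => ⟨hx.1, le_antisymm hx.2 (hBi x hx.1).1⟩
  have hΦb : Φ (b i) < 0 := by
    have : B ∩ {x | x i ≤ b i} = B := inter_eq_left.2 fun x hx => (hBi x hx).2
    rwa [hΦint, this]
  have hincr : ∀ u v, u ≤ v → ∫ x in B ∩ {x | x i ∈ Icc u v}, g x ∂μ = Φ v - Φ u := by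
    intro u v huv
    have hsplit : (B ∩ {x | x i ∈ Icc u v}) ∪ (B ∩ {x | x i ≤ u}) = B ∩ {x | x i ≤ v} := by
      rw [← inter_union_distrib_left]
      congr 1
      ext x
      refine ⟨fun h => h.elim (fun h => h.2) fun h => le_trans h huv, fun h => ?_⟩
      exact (le_total u (x i)).imp (fun hu => ⟨hu, h⟩) id
    have hdisj : AEDisjoint μ (B ∩ {x | x i ∈ Icc u v}) (B ∩ {x | x i ≤ u}) :=
      measure_mono_null (t := B ∩ {x | x i = u}) (fun x hx => ⟨hx.1.1, le_antisymm hx.2.2 hx.1.2.1⟩) (hslice u)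
    rw [hΦint, hΦint, eq_sub_iff_add_eq, ← hsplit, setIntegral_union₀ hdisj
      (hBm.inter (hle u)).nullMeasurableSet (hg.mono_set inter_subset_left)
      (hg.mono_set inter_subset_left)]
  set ν := (μ.restrict B).map fun x => x i
  have : IsFiniteMeasure (μ.restrict B) := ⟨by simpa using hfin⟩
  have hν : ∀ s, MeasurableSet s → ν s = μ (B ∩ {x | x i ∈ s}) := fun s hs => by
    rw [Measure.map_apply (measurable_pi_apply i) hs, Measure.restrict_apply
      (measurable_pi_apply i hs), inter_comm]
    rfl
  obtain ⟨J, u, v, hJ, hdisj, hJuv, hnull⟩ :=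
    exists_interval_decomposition hΦ (hab i) (hΦa ▸ hΦb) ν hδ
  refine ⟨(fun s => B ∩ {x | x i ∈ Icc (u s) (v s)}) '' J, hJ.image _, ?_, ?_, ?_, ?_, ?_⟩
  · rintro _ ⟨s, hs, rfl⟩ _ ⟨s', hs', rfl⟩ hne
    have hss' : s ≠ s' := fun h => hne (h ▸ rfl)
    exact ((hdisj hs hs' hss').preimage fun x : Fin n → ℝ => x i).mono
      inter_subset_right inter_subset_right
  · rintro _ ⟨s, hs, rfl⟩
    obtain ⟨h1, h2, h3, -⟩ := hJuv s hs
    rw [hBab]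
    exact IsRect.slab hab i h1 h2 h3
  · rintro _ ⟨s, hs, rfl⟩
    exact inter_subset_left
  · rintro _ ⟨s, hs, rfl⟩
    obtain ⟨h1, h2, h3, h4⟩ := hJuv s hs
    simp only
    rw [hincr _ _ h2.le]
    rcases h4 with ⟨h4, h5⟩ | ⟨h4, h5⟩
    · exact Or.inl ⟨sub_eq_zero.2 h4, hν _ measurableSet_Icc ▸ h5⟩
    · refine Or.inr ⟨sub_neg.2 h4, fun x hx y hy => ?_⟩
      have hx := hx.2
      have hy := hy.2
      rw [abs_sub_le_iff]
      constructor <;> linarith [hx.1, hx.2, hy.1, hy.2]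
  · rw [hν _ (measurableSet_Icc.diff (MeasurableSet.biUnion hJ fun _ _ => measurableSet_Icc))]
      at hnull
    refine measure_mono_null ?_ hnull
    rintro x ⟨hx, hxn⟩
    refine ⟨hx, hBi x hx, fun hmem => hxn ?_⟩
    obtain ⟨s, hs, hxs⟩ := mem_iUnion₂.1 hmem
    exact ⟨_, ⟨s, hs, rfl⟩, hx, hxs⟩

section Decomposition

variable {n : ℕ} {μ : Measure (Fin n → ℝ)} {g : (Fin n → ℝ) → ℝ} {P Q : Set (Fin n → ℝ) → Prop}
  {B : Set (Fin n → ℝ)} {T : Set (Set (Fin n → ℝ))}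

theorem isSunDecomposition_singleton (hB : IsRect n B)
    (h : (∫ x in B, g x ∂μ = 0 ∧ 0 < μ B) ∨ (∫ x in B, g x ∂μ < 0 ∧ P B)) :
    IsSunDecomposition μ g P B {B} where
  countable := countable_singleton B
  disjoint := pairwiseDisjoint_singleton B id
  isRect := by rintro r rfl; exact hB
  subset := by rintro r rfl; exact Subset.rfl
  sign := by rintro r rfl; exact h
  null := by simp

theorem IsSunDecomposition.bind (hT : IsSunDecomposition μ g P B T)
    {D : Set (Fin n → ℝ) → Set (Set (Fin n → ℝ))}
    (hD : ∀ r ∈ T, IsSunDecomposition μ g Q r (D r)) :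
    IsSunDecomposition μ g Q B (⋃ r ∈ T, D r) where
  countable := hT.countable.biUnion fun r hr => (hD r hr).countable
  disjoint := by
    intro s hs s' hs' hne
    obtain ⟨r, hr, hsr⟩ := mem_iUnion₂.1 hs
    obtain ⟨r', hr', hsr'⟩ := mem_iUnion₂.1 hs'
    rcases eq_or_ne r r' with rfl | hrr'
    · exact (hD r hr).disjoint hsr hsr' hne
    · exact (hT.disjoint hr hr' hrr').mono ((hD r hr).subset s hsr) ((hD r' hr').subset s' hsr')
  isRect := by
    intro s hs
    obtain ⟨r, hr, hsr⟩ := mem_iUnion₂.1 hs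
    exact (hD r hr).isRect s hsr
  subset := by
    intro s hs
    obtain ⟨r, hr, hsr⟩ := mem_iUnion₂.1 hs
    exact ((hD r hr).subset s hsr).trans (hT.subset r hr)
  sign := by
    intro s hs
    obtain ⟨r, hr, hsr⟩ := mem_iUnion₂.1 hs
    exact (hD r hr).sign s hsr
  null := by
    have hnull : μ (⋃ r ∈ T, r \ ⋃₀ D r) = 0 :=
      (measure_biUnion_null_iff hT.countable).2 fun r hr => (hD r hr).null
    refine measure_mono_null ?_ (measure_union_null hT.null hnull)
    rintro x ⟨hx, hxn⟩
    by_cases hxT : x ∈ ⋃₀ T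
    · obtain ⟨r, hr, hxr⟩ := hxT
      refine Or.inr (mem_iUnion₂.2 ⟨r, hr, hxr, ?_⟩)
      rintro ⟨s, hs, hxs⟩
      exact hxn ⟨s, mem_iUnion₂.2 ⟨r, hr, hs⟩, hxs⟩
    · exact Or.inl ⟨hx, hxT⟩

/-- Decompose further the rectangles with negative integral, keeping the balanced ones. -/
theorem IsSunDecomposition.exists_refinement (hT : IsSunDecomposition μ g P B T)
    (hD : ∀ r ∈ T, ∫ x in r, g x ∂μ < 0 → P r → ∃ D, IsSunDecomposition μ g Q r D) :
    ∃ U, IsSunDecomposition μ g Q B U ∧ ∀ r ∈ T, ∫ x in r, g x ∂μ = 0 → r ∈ U := by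
  have h : ∀ r, ∃ D, r ∈ T → IsSunDecomposition μ g Q r D ∧ (∫ x in r, g x ∂μ = 0 → r ∈ D) := by
    intro r
    by_cases hr : r ∈ T
    · rcases hT.sign r hr with h | ⟨h, hP⟩
      · exact ⟨{r}, fun _ => ⟨isSunDecomposition_singleton (hT.isRect r hr) (Or.inl h),
          fun _ => mem_singleton r⟩⟩
      · obtain ⟨D, hD⟩ := hD r hr h hP
        exact ⟨D, fun _ => ⟨hD, fun h0 => absurd h0 h.ne⟩⟩
    · exact ⟨∅, fun h => absurd h hr⟩
  choose D hD using h
  exact ⟨⋃ r ∈ T, D r, hT.bind fun r hr => (hD r hr).1,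
    fun r hr h0 => mem_biUnion hr ((hD r hr).2 h0)⟩

theorem exists_isSunDecomposition (hμ : ∀ P : Set (Fin n → ℝ), IsRect n P → μ (frontier P) = 0)
    (hB : IsRect n B) (hfin : μ B < ⊤) (hg : IntegrableOn g B μ) (hneg : ∫ x in B, g x ∂μ < 0)
    {δ : ℝ} (hδ : 0 < δ) :
    ∃ T, IsSunDecomposition μ g (fun r => ∀ x ∈ r, ∀ y ∈ r, dist x y ≤ δ) B T := by
  have h : ∀ S : Finset (Fin n), ∃ T, IsSunDecomposition μ g
      (fun r => ∀ i ∈ S, ∀ x ∈ r, ∀ y ∈ r, |x i - y i| ≤ δ) B T := by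
    intro S
    induction S using Finset.induction_on with
    | empty => exact ⟨{B}, isSunDecomposition_singleton hB (Or.inr ⟨hneg, by simp⟩)⟩
    | insert i S _ ih =>
      obtain ⟨T, hT⟩ := ih
      obtain ⟨U, hU, -⟩ := hT.exists_refinement
        (Q := fun r => ∀ j ∈ insert i S, ∀ x ∈ r, ∀ y ∈ r, |x j - y j| ≤ δ) (by
          intro r hr hr0 hS
          have hrB := hT.subset r hr
          obtain ⟨D, hD⟩ := exists_isSunDecomposition_coord hμ (hT.isRect r hr)
            ((measure_mono hrB).trans_lt hfin) (hg.mono_set hrB) hr0 i hδ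
          refine ⟨D, hD.countable, hD.disjoint, hD.isRect, hD.subset, fun s hs => ?_, hD.null⟩
          refine (hD.sign s hs).imp id fun h => ⟨h.1, fun j hj x hx y hy => ?_⟩
          rcases Finset.mem_insert.1 hj with rfl | hj
          · exact h.2 x hx y hy
          · exact hS j hj x (hD.subset s hs hx) y (hD.subset s hs hy))
      exact ⟨U, hU⟩
  obtain ⟨T, hT⟩ := h Finset.univ
  refine ⟨T, hT.countable, hT.disjoint, hT.isRect, hT.subset, fun s hs => ?_, hT.null⟩
  refine (hT.sign s hs).imp id fun h => ⟨h.1, fun x hx y hy => ?_⟩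
  exact (dist_pi_le_iff hδ.le).2 fun i => h.2 i (Finset.mem_univ i) x hx y hy

theorem exists_seq_isSunDecomposition
    (hμ : ∀ P : Set (Fin n → ℝ), IsRect n P → μ (frontier P) = 0)
    (hB : IsRect n B) (hfin : μ B < ⊤) (hg : IntegrableOn g B μ)
    (hneg : ∫ x in B, g x ∂μ < 0) :
    ∃ T : ℕ → Set (Set (Fin n → ℝ)),
      (∀ k : ℕ, IsSunDecomposition μ g (fun r => ∀ x ∈ r, ∀ y ∈ r, dist x y ≤ 1 / ((k : ℝ) + 1))
        B (T k)) ∧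
      ∀ k, ∀ r ∈ T k, ∫ x in r, g x ∂μ = 0 → r ∈ T (k + 1) := by
  set P : ℕ → Set (Fin n → ℝ) → Prop :=
    fun k r => ∀ x ∈ r, ∀ y ∈ r, dist x y ≤ 1 / ((k : ℝ) + 1)
  have hstep : ∀ (k : ℕ) (T : Set (Set (Fin n → ℝ))), IsSunDecomposition μ g (P k) B T →
      ∃ U, IsSunDecomposition μ g (P (k + 1)) B U ∧ ∀ r ∈ T, ∫ x in r, g x ∂μ = 0 → r ∈ U :=
    fun k T hT => hT.exists_refinement fun r hr h0 _ =>
      exists_isSunDecomposition hμ (hT.isRect r hr)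
        ((measure_mono (hT.subset r hr)).trans_lt hfin) (hg.mono_set (hT.subset r hr)) h0
        Nat.one_div_pos_of_nat
  choose! N hN hN' using hstep
  obtain ⟨T₀, hT₀⟩ : ∃ T, IsSunDecomposition μ g (P 0) B T :=
    exists_isSunDecomposition hμ hB hfin hg hneg Nat.one_div_pos_of_nat
  have hall : ∀ k, IsSunDecomposition μ g (P k) B (Nat.rec T₀ (fun k T => N k T) k) := by
    intro k
    induction k with
    | zero => exact hT₀
    | succ k ih => exact hN k _ ih
  exact ⟨fun k => Nat.rec T₀ (fun k T => N k T) k, hall, fun k => hN' k _ (hall k)⟩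

end Decomposition

theorem ae_nonpos_of_forall_setIntegral_isClosed_nonpos {X : Type*} [TopologicalSpace X]
    [MeasurableSpace X] [BorelSpace X] {ρ : Measure X} [IsFiniteMeasure ρ] [ρ.WeaklyRegular]
    {g : X → ℝ} (hg : Integrable g ρ) (h : ∀ K, IsClosed K → ∫ x in K, g x ∂ρ ≤ 0) :
    g ≤ᵐ[ρ] 0 := by
  have key : 0 ≤ᵐ[ρ] -g := by
    refine ae_nonneg_of_forall_setIntegral_nonneg hg.neg fun s hs _ => ?_
    have hK : ∀ k : ℕ, ∃ K ⊆ s, IsClosed K ∧ ρ (s \ K) < ((k : ENNReal) + 1)⁻¹ := fun k =>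
      hs.exists_isClosed_sdiff_lt (measure_ne_top ρ s) (by simp)
    choose K hKs hKc hKlt using hK
    have hlim : Tendsto (fun k => ρ (s \ K k)) atTop (nhds 0) := by
      refine tendsto_of_tendsto_of_tendsto_of_le_of_le tendsto_const_nhds
        ((tendsto_add_atTop_iff_nat 1).2 ENNReal.tendsto_inv_nat_nhds_zero)
        (fun _ => zero_le) fun k => ?_
      simpa using (hKlt k).le
    have hlim' := hg.hasFiniteIntegral.tendsto_setIntegral_nhds_zero hlim
    have hle : ∀ k, ∫ x in s, g x ∂ρ ≤ ∫ x in s \ K k, g x ∂ρ := by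
      intro k
      rw [setIntegral_sdiff₀ (hKc k).measurableSet.nullMeasurableSet hg.integrableOn (hKs k)]
      linarith [h (K k) (hKc k)]
    have := ge_of_tendsto' hlim' hle
    simp only [Pi.neg_apply, integral_neg]
    linarith
  filter_upwards [key] with x hx
  simpa using hx

theorem setIntegral_sUnion {X : Type*} [MeasurableSpace X] {μ : Measure X} {g : X → ℝ}
    {S : Set (Set X)} (hS : S.Countable) (hd : S.PairwiseDisjoint id)
    (hm : ∀ r ∈ S, MeasurableSet r) (hg : IntegrableOn g (⋃₀ S) μ) :
    ∫ x in ⋃₀ S, g x ∂μ = ∑' r : S, ∫ x in (r : Set X), g x ∂μ := by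
  have := hS.to_subtype
  rw [sUnion_eq_iUnion] at hg ⊢
  exact integral_iUnion (fun r => hm r r.2)
    (fun r s hrs => hd r.2 s.2 (Subtype.coe_injective.ne hrs)) hg

/-- Rising sun lemma for a function with negative integral, at height zero. -/
theorem exists_balanced_rectangles {n : ℕ} {μ : Measure (Fin n → ℝ)}
    (hμ : ∀ P : Set (Fin n → ℝ), IsRect n P → μ (frontier P) = 0)
    {g : (Fin n → ℝ) → ℝ} {B : Set (Fin n → ℝ)} (hB : IsRect n B) (hfin : μ B < ⊤)
    (hg : IntegrableOn g B μ) (hneg : ∫ x in B, g x ∂μ < 0) :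
    ∃ F : Set (Set (Fin n → ℝ)), F.Countable ∧ F.PairwiseDisjoint id ∧
      (∀ r ∈ F, IsRect n r ∧ r ⊆ B ∧ 0 < μ r ∧ ∫ x in r, g x ∂μ = 0) ∧
      ∀ᵐ x ∂μ.restrict (B \ ⋃₀ F), g x ≤ 0 := by
  obtain ⟨T, hT, hTsucc⟩ := exists_seq_isSunDecomposition hμ hB hfin hg hneg
  have hTmono : ∀ j k, j ≤ k → ∀ r ∈ T j, ∫ x in r, g x ∂μ = 0 → r ∈ T k := by
    intro j k hjk r hr h0
    induction k, hjk using Nat.le_induction with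
    | base => exact hr
    | succ k _ ih => exact hTsucc k r ih h0
  set F : Set (Set (Fin n → ℝ)) := ⋃ k, {r ∈ T k | ∫ x in r, g x ∂μ = 0}
  have hF : ∀ r, r ∈ F ↔ ∃ k, r ∈ T k ∧ ∫ x in r, g x ∂μ = 0 := fun r => mem_iUnion
  have hFc : F.Countable := countable_iUnion fun k => (hT k).countable.mono fun r hr => hr.1
  have hFrect : ∀ r ∈ F, IsRect n r := fun r hr => by
    obtain ⟨k, hk, -⟩ := (hF r).1 hr
    exact (hT k).isRect r hk
  refine ⟨F, hFc, ?_, ?_, ?_⟩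
  · intro r hr s hs hne
    obtain ⟨j, hj, hj0⟩ := (hF r).1 hr
    obtain ⟨k, hk, hk0⟩ := (hF s).1 hs
    exact (hT (max j k)).disjoint (hTmono j _ (le_max_left _ _) r hj hj0)
      (hTmono k _ (le_max_right _ _) s hk hk0) hne
  · intro r hr
    obtain ⟨k, hk, hk0⟩ := (hF r).1 hr
    exact ⟨(hT k).isRect r hk, (hT k).subset r hk,
      ((hT k).sign r hk).elim (fun h => h.2) (fun h => absurd hk0 h.1.ne), hk0⟩
  have hEm : MeasurableSet (B \ ⋃₀ F) :=
    hB.measurableSet.diff (.sUnion hFc fun r hr => (hFrect r hr).measurableSet)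
  set E := B \ ⋃₀ F
  have : IsFiniteMeasure (μ.restrict E) :=
    ⟨by simpa using (measure_mono sdiff_subset).trans_lt hfin⟩
  refine ae_nonpos_of_forall_setIntegral_isClosed_nonpos (hg.mono_set sdiff_subset)
    fun K hK => ?_
  set S : ℕ → Set (Set (Fin n → ℝ)) :=
    fun k => {r ∈ T k | ∫ x in r, g x ∂μ < 0 ∧ (r ∩ K).Nonempty}
  have hST : ∀ k, S k ⊆ T k := fun k r hr => hr.1
  have hSB : ∀ k, ⋃₀ S k ⊆ B := fun k => sUnion_subset fun r hr => (hT k).subset r hr.1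
  have hSm : ∀ k, MeasurableSet (⋃₀ S k) := fun k =>
    .sUnion ((hT k).countable.mono (hST k)) fun r hr => ((hT k).isRect r hr.1).measurableSet
  have hSneg : ∀ k, ∫ x in B, (⋃₀ S k).indicator g x ∂μ ≤ 0 := by
    intro k
    rw [setIntegral_indicator (hSm k), inter_eq_right.2 (hSB k),
      setIntegral_sUnion ((hT k).countable.mono (hST k)) ((hT k).disjoint.subset (hST k))
        (fun r hr => ((hT k).isRect r hr.1).measurableSet) (hg.mono_set (hSB k))]
    exact tsum_nonpos fun r => r.2.2.1.le
  have hlim : Tendsto (fun k => ∫ x in B, (⋃₀ S k).indicator g x ∂μ) atTop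
      (nhds (∫ x in B, (K ∩ E).indicator g x ∂μ)) := by
    refine tendsto_integral_of_dominated_convergence (fun x => ‖g x‖)
      (fun k => hg.aestronglyMeasurable.indicator (hSm k)) hg.norm
      (fun k => Eventually.of_forall fun x => norm_indicator_le_norm_self _ _) ?_
    rw [ae_restrict_iff' hB.measurableSet]
    have hcov : ∀ᵐ x ∂μ, ∀ k, x ∉ B \ ⋃₀ T k :=
      ae_all_iff.2 fun k => compl_mem_ae_iff.2 (hT k).null
    filter_upwards [hcov] with x hx hxB
    refine tendsto_const_nhds.congr' ?_
    by_cases hxE : x ∈ E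
    · by_cases hxK : x ∈ K
      · refine Eventually.of_forall fun k => ?_
        beta_reduce
        rw [indicator_of_mem (show x ∈ K ∩ E from ⟨hxK, hxE⟩), indicator_of_mem]
        obtain ⟨r, hr, hxr⟩ : x ∈ ⋃₀ T k := by
          by_contra hcon
          exact hx k ⟨hxB, hcon⟩
        refine ⟨r, ⟨hr, ?_, x, hxr, hxK⟩, hxr⟩
        rcases (hT k).sign r hr with h | h
        · exact absurd ⟨r, (hF r).2 ⟨k, hr, h.1⟩, hxr⟩ hxE.2
        · exact h.1
      · obtain ⟨ε, hε, hball⟩ := Metric.isOpen_iff.1 hK.isOpen_compl x hxK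
        obtain ⟨N, hN⟩ := exists_nat_one_div_lt hε
        filter_upwards [eventually_ge_atTop N] with k hk
        rw [indicator_of_notMem fun h => hxK h.1, indicator_of_notMem]
        rintro ⟨r, ⟨hr, hr0, y, hyr, hyK⟩, hxr⟩
        have hd := (((hT k).sign r hr).resolve_left fun h => hr0.ne h.1).2 y hyr x hxr
        refine hball ?_ hyK
        exact (hd.trans (Nat.one_div_le_one_div hk)).trans_lt hN
    · obtain ⟨r, hr, hxr⟩ : x ∈ ⋃₀ F := by
        by_contra hcon
        exact hxE ⟨hxB, hcon⟩
      obtain ⟨j, hj, hj0⟩ := (hF r).1 hr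
      filter_upwards [eventually_ge_atTop j] with k hk
      rw [indicator_of_notMem fun h => hxE h.2, indicator_of_notMem]
      rintro ⟨s, ⟨hs, hs0, -⟩, hxs⟩
      have hne : r ≠ s := by
        rintro rfl
        exact hs0.ne hj0
      exact disjoint_left.1 ((hT k).disjoint (hTmono j k hk r hj hj0) hs hne) hxr hxs
  have hle := le_of_tendsto' hlim hSneg
  rw [setIntegral_indicator (hK.measurableSet.inter hEm),
    inter_eq_right.2 (inter_subset_right.trans sdiff_subset)] at hle
  rwa [Measure.restrict_restrict hK.measurableSet]

/-- Riesz's Rising Sun lemma (non-doubling version): for a Borel measure `μ` on `ℝⁿ` with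
null rectangle boundaries, a rectangle `R` with `0 < μ(R) < ∞`, `h ∈ L¹(R,μ)` real-valued
and `λ > ⨍_R h dμ`, there is an at most countable family of pairwise disjoint rectangles
`R_j ⊆ R` with `⨍_{R_j} h dμ = λ` and `h ≤ λ` μ-a.e. on `R \ ⋃_j R_j`; moreover if `h ≥ 0`
then `∑_j μ(R_j) ≤ (μ(R)/λ) ⨍_R h dμ`. -/
theorem riesz_rising_sun (n : ℕ) (μ : Measure (Fin n → ℝ))
    (hboundary : ∀ P : Set (Fin n → ℝ), IsRect n P → μ (frontier P) = 0)
    (R : Set (Fin n → ℝ)) (hR : IsRect n R) (hR0 : 0 < μ R) (hRfin : μ R < ⊤)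
    (h : (Fin n → ℝ) → ℝ) (hint : IntegrableOn h R μ)
    (lam : ℝ) (hlam : (⨍ x in R, h x ∂μ) < lam) :
    ∃ F : Set (Set (Fin n → ℝ)), F.Countable ∧ F.PairwiseDisjoint id ∧
      (∀ r ∈ F, IsRect n r ∧ r ⊆ R ∧ 0 < μ r ∧ (⨍ x in r, h x ∂μ) = lam) ∧
      (∀ᵐ x ∂μ.restrict (R \ ⋃₀ F), h x ≤ lam) ∧
      ((∀ x, 0 ≤ h x) →
        ∑' (r : F), μ (r : Set (Fin n → ℝ)) ≤ ENNReal.ofReal ((∫ x in R, h x ∂μ) / lam)) := by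
  have hg : ∀ r ⊆ R, IntegrableOn (fun x => h x - lam) r μ ∧
      ∫ x in r, (h x - lam) ∂μ = (∫ x in r, h x ∂μ) - μ.real r * lam := by
    intro r hr
    have hi := hint.mono_set hr
    have hc : IntegrableOn (fun _ => lam) r μ :=
      integrableOn_const ((measure_mono hr).trans_lt hRfin).ne
    refine ⟨hi.sub hc, ?_⟩
    rw [integral_sub hi hc, setIntegral_const, smul_eq_mul]
  have hreal : ∀ r ⊆ R, 0 < μ r → 0 < μ.real r := fun r hr h0 =>
    ENNReal.toReal_pos h0.ne' ((measure_mono hr).trans_lt hRfin).ne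
  have hRpos := hreal R Subset.rfl hR0
  have hlam' : ∫ x in R, h x ∂μ < μ.real R * lam := by
    rw [setAverage_eq, smul_eq_mul, inv_mul_lt_iff₀ hRpos] at hlam
    exact hlam
  obtain ⟨F, hFc, hFd, hF, hae⟩ := exists_balanced_rectangles hboundary hR hRfin
    (hg R Subset.rfl).1 (by rw [(hg R Subset.rfl).2]; linarith)
  refine ⟨F, hFc, hFd, fun r hr => ?_, ?_, fun hpos => ?_⟩
  · obtain ⟨h1, h2, h3, h4⟩ := hF r hr
    refine ⟨h1, h2, h3, ?_⟩
    rw [(hg r h2).2, sub_eq_zero] at h4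
    rw [setAverage_eq, h4, smul_eq_mul, inv_mul_cancel_left₀ (hreal r h2 h3).ne']
  · filter_upwards [hae] with x hx
    linarith
  · have hFm : ∀ r ∈ F, MeasurableSet r := fun r hr => (hF r hr).1.measurableSet
    have hFR : ⋃₀ F ⊆ R := sUnion_subset fun r hr => (hF r hr).2.1
    have hlam0 : 0 < lam := by
      have : 0 ≤ ∫ x in R, h x ∂μ := integral_nonneg hpos
      exact pos_of_mul_pos_right (this.trans_lt hlam') hRpos.le
    have hsum : ∑' r : F, μ (r : Set (Fin n → ℝ)) = μ (⋃₀ F) :=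
      (measure_sUnion hFc hFd hFm).symm
    have hbal : ∫ x in ⋃₀ F, (h x - lam) ∂μ = 0 := by
      rw [setIntegral_sUnion hFc hFd hFm (hg _ hFR).1]
      simp [fun r : F => (hF r r.2).2.2.2]
    rw [(hg _ hFR).2, sub_eq_zero] at hbal
    have hle : ∫ x in ⋃₀ F, h x ∂μ ≤ ∫ x in R, h x ∂μ :=
      setIntegral_mono_set hint (Eventually.of_forall hpos) hFR.eventuallyLE
    rw [hsum, ENNReal.le_ofReal_iff_toReal_le ((measure_mono hFR).trans_lt hRfin).ne
      (div_nonneg (integral_nonneg hpos) hlam0.le), le_div_iff₀ hlam0]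
    exact hbal ▸ hle
end

section
/- Let ψ : [0,∞) → [0,∞) be any function with ψ(0) = 0 and ψ(t) → ∞ as t → ∞. Then there exist t₀ ∈ [0,∞) and a continuous nondecreasing function φ : [0,∞) → [0,∞) such that φ(t) = 0 for t ∈ [0, t₀], φ restricted to [t₀, ∞) is concave and strictly increasing with φ(t) → ∞ as t → ∞, and φ(t) ≤ ψ(t) for all t ∈ [0,∞). (One may take φ to be a polygonal function whose graph on [t₀,∞) consists of consecutive segments joining points (t_n, n), n ∈ ℕ.) -/
open Set Filter

/-- The pointwise minimum over `n` of the affine functions `x ↦ n + x / a n` is attained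
on `[0,∞)`. -/
theorem exists_min_affine_family (a : ℕ → ℝ) (ha : ∀ n, 1 ≤ a n) :
    ∃ g : ℝ → ℝ, (∀ x, 0 ≤ x → ∀ n : ℕ, g x ≤ n + x / a n) ∧
      ∀ x, 0 ≤ x → ∃ n : ℕ, g x = n + x / a n := by
  have h_nonneg : ∀ x, 0 ≤ x → ∀ n : ℕ, 0 ≤ x / a n := fun x hx n =>
    div_nonneg hx (zero_le_one.trans (ha n))
  have h_min : ∀ x : ℝ, 0 ≤ x → ∃ m : ℕ, ∀ n : ℕ, (m : ℝ) + x / a m ≤ n + x / a n := by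
    intro x hx
    obtain ⟨N, hN⟩ := exists_nat_ge (x / a 0)
    obtain ⟨m, -, hm⟩ := Finset.exists_min_image (Finset.range (N + 1))
      (fun n : ℕ => (n : ℝ) + x / a n) ⟨0, by simp⟩
    refine ⟨m, fun n => ?_⟩
    by_cases hn : n < N + 1
    · exact hm n (Finset.mem_range.2 hn)
    · have h0 := hm 0 (by simp)
      have hNn : (N : ℝ) ≤ n := by exact_mod_cast (by omega : N ≤ n)
      have := h_nonneg x hx n
      simp only [Nat.cast_zero, zero_add] at h0
      linarith
  choose! m hm using h_min
  exact ⟨fun x => m x + x / a (m x), hm, fun x _ => ⟨m x, rfl⟩⟩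

/-- The auxiliary construction in the proof of Theorem 1.3 of the paper: for any
`ψ : [0,∞) → [0,∞)` with `ψ(0)=0` and `ψ(t) → ∞` there are `t₀ ≥ 0` and a continuous
nondecreasing `φ : [0,∞) → [0,∞)` vanishing on `[0,t₀]`, concave and strictly increasing
on `[t₀,∞)`, tending to `∞`, with `φ ≤ ψ` on `[0,∞)`. -/
theorem exists_concave_polygonal_minorant (ψ : ℝ → ℝ)
    (hzero : ψ 0 = 0)
    (hnonneg : ∀ t, 0 ≤ t → 0 ≤ ψ t)
    (htop : Tendsto ψ atTop atTop) :
    ∃ (t₀ : ℝ) (φ : ℝ → ℝ), 0 ≤ t₀ ∧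
      ContinuousOn φ (Set.Ici 0) ∧
      MonotoneOn φ (Set.Ici 0) ∧
      (∀ t, 0 ≤ t → 0 ≤ φ t) ∧
      (∀ t ∈ Set.Icc 0 t₀, φ t = 0) ∧
      ConcaveOn ℝ (Set.Ici t₀) φ ∧
      StrictMonoOn φ (Set.Ici t₀) ∧
      Tendsto φ atTop atTop ∧
      (∀ t, 0 ≤ t → φ t ≤ ψ t) := by
  have h_ev : ∀ n : ℕ, ∃ T : ℝ, ∀ t, T ≤ t → (n : ℝ) + 1 ≤ ψ t := fun n =>
    eventually_atTop.1 (htop.eventually_ge_atTop _)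
  choose T hT using h_ev
  obtain ⟨a, ha, haT⟩ : ∃ a : ℕ → ℝ, (∀ n, 1 ≤ a n) ∧ ∀ n, T (n + 1) ≤ a n :=
    ⟨fun n => max 1 (T (n + 1)), fun n => le_max_left _ _, fun n => le_max_right _ _⟩
  have ha_pos : ∀ n, 0 < a n := fun n => zero_lt_one.trans_le (ha n)
  obtain ⟨g, hg_le, hg_eq⟩ := exists_min_affine_family a ha
  have hg_nonneg : ∀ x, 0 ≤ x → 0 ≤ g x := by
    intro x hx
    obtain ⟨n, hn⟩ := hg_eq x hx
    rw [hn]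
    have := ha_pos n
    positivity
  have hg_zero : g 0 = 0 := le_antisymm (by simpa using hg_le 0 le_rfl 0) (hg_nonneg 0 le_rfl)
  have hg_strict : ∀ x y, 0 ≤ x → x < y → g x < g y := by
    intro x y hx hxy
    obtain ⟨n, hn⟩ := hg_eq y (hx.trans hxy.le)
    have := div_lt_div_of_pos_right hxy (ha_pos n)
    linarith [hg_le x hx n]
  have hg_mono : ∀ x y, 0 ≤ x → x ≤ y → g x ≤ g y := by
    intro x y hx hxy
    rcases hxy.eq_or_lt with rfl | h
    · exact le_rfl
    · exact (hg_strict x y hx h).le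
  have hg_lip : ∀ x y, 0 ≤ x → 0 ≤ y → g x ≤ g y + |x - y| := by
    intro x y hx hy
    obtain ⟨n, hn⟩ := hg_eq y hy
    have h1 : (x - y) / a n ≤ |x - y| :=
      (div_le_div_of_nonneg_right (le_abs_self _) (ha_pos n).le).trans
        (div_le_self (abs_nonneg _) (ha n))
    rw [sub_div] at h1
    linarith [hg_le x hx n]
  have hg_cont : ContinuousOn g (Set.Ici 0) := by
    refine (LipschitzOnWith.of_le_add_mul (K := 1) ?_).continuousOn
    intro x hx y hy
    simpa [Real.dist_eq] using hg_lip x y hx hy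
  have hg_conc : ∀ x y p q, 0 ≤ x → 0 ≤ y → 0 ≤ p → 0 ≤ q → p + q = 1 →
      p * g x + q * g y ≤ g (p * x + q * y) := by
    intro x y p q hx hy hp hq hpq
    obtain ⟨n, hn⟩ := hg_eq (p * x + q * y) (by positivity)
    have h1 := mul_le_mul_of_nonneg_left (hg_le x hx n) hp
    have h2 := mul_le_mul_of_nonneg_left (hg_le y hy n) hq
    have h3 : (n : ℝ) + (p * x + q * y) / a n
        = p * (n + x / a n) + q * (n + y / a n) := by
      rw [add_div, mul_div_assoc, mul_div_assoc]
      linear_combination -(n : ℝ) * hpq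
    linarith
  have hg_top : Tendsto g atTop atTop := by
    refine tendsto_atTop.2 fun C => ?_
    obtain ⟨N, hN⟩ := exists_nat_ge C
    have h_fin : ∀ᶠ x : ℝ in atTop, ∀ n ∈ Finset.range N, C ≤ x / a n :=
      (eventually_all_finset _).2 fun n _ =>
        (tendsto_id.atTop_div_const (ha_pos n)).eventually_ge_atTop C
    filter_upwards [h_fin, eventually_ge_atTop 0] with x hx hx0
    obtain ⟨n, hn⟩ := hg_eq x hx0
    rw [hn]
    by_cases h : n < N
    · linarith [hx n (Finset.mem_range.2 h), (Nat.cast_nonneg n : (0 : ℝ) ≤ n)]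
    · have hNn : (N : ℝ) ≤ n := by exact_mod_cast not_lt.1 h
      linarith [div_nonneg hx0 (ha_pos n).le]
  set t₀ : ℝ := max 0 (T 0)
  have ht₀ : 0 ≤ t₀ := le_max_left _ _
  have h_on : ∀ t, t₀ ≤ t → max (t - t₀) 0 = t - t₀ := fun t ht => max_eq_left (sub_nonneg.2 ht)
  have h_off : ∀ t, t ≤ t₀ → g (max (t - t₀) 0) = 0 := fun t ht => by
    rw [max_eq_right (sub_nonpos.2 ht), hg_zero]
  refine ⟨t₀, fun t => g (max (t - t₀) 0), ht₀, ?_, ?_, ?_, ?_, ⟨convex_Ici _, ?_⟩, ?_, ?_, ?_⟩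
  · exact hg_cont.comp (by fun_prop) fun t _ => mem_Ici.2 (le_max_right _ _)
  · intro s _ t _ hst
    exact hg_mono _ _ (le_max_right _ _) (max_le_max_right _ (sub_le_sub_right hst _))
  · exact fun t _ => hg_nonneg _ (le_max_right _ _)
  · exact fun t ht => h_off t ht.2
  · intro s hs t ht p q hp hq hpq
    have hst : t₀ ≤ p * s + q * t := convex_Ici t₀ hs ht hp hq hpq
    change p * g (max (s - t₀) 0) + q * g (max (t - t₀) 0) ≤ g (max (p * s + q * t - t₀) 0)
    rw [h_on s hs, h_on t ht, h_on _ hst]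
    have h_arg : p * s + q * t - t₀ = p * (s - t₀) + q * (t - t₀) := by
      linear_combination t₀ * hpq
    rw [h_arg]
    exact hg_conc _ _ p q (sub_nonneg.2 hs) (sub_nonneg.2 ht) hp hq hpq
  · intro s hs t ht hst
    change g (max (s - t₀) 0) < g (max (t - t₀) 0)
    rw [h_on s hs, h_on t ht]
    exact hg_strict _ _ (sub_nonneg.2 hs) (sub_lt_sub_right hst _)
  · refine hg_top.comp (tendsto_atTop_mono (fun t => le_max_left _ _) ?_)
    exact tendsto_atTop_add_const_right _ (-t₀) tendsto_id
  · intro t ht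
    rcases le_total t t₀ with h | h
    · simpa only [h_off t h] using hnonneg t ht
    simp only [h_on t h]
    have h_one : 1 ≤ ψ t := by simpa using hT 0 t ((le_max_right _ _).trans h)
    set n := ⌊ψ t - 1⌋₊
    have h_lower : (n : ℝ) ≤ ψ t - 1 := Nat.floor_le (sub_nonneg.2 h_one)
    have h_upper : ψ t - 1 < n + 1 := Nat.lt_floor_add_one _
    have h_lt : t < T (n + 1) := by
      by_contra! hle
      have := hT (n + 1) t hle
      push_cast at this
      linarith
    have h_div : (t - t₀) / a n ≤ 1 := (div_le_one (ha_pos n)).2 (by linarith [haT n])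
    linarith [hg_le (t - t₀) (sub_nonneg.2 h) n]
end

section
/- Let t₀ ≥ 0 and let φ : [0,∞) → [0,∞) be nondecreasing with φ(t) = 0 for t ∈ [0, t₀] and φ concave on [t₀, ∞). Let (Ω, μ) be a finite measure space and let A, B : Ω → [0,∞) be measurable. Then ∫_Ω φ(A + B) dμ ≤ μ(Ω) φ(2t₀) + 2 ∫_Ω φ(A) dμ + 2 ∫_Ω φ(B) dμ. -/
open MeasureTheory Set Filter

/-- A concave function on `[t₀,∞)` vanishing at `t₀` has decreasing chord slopes from `t₀`. -/
theorem ConcaveOn.sub_mul_le_sub_mul_of_eq_zero {t₀ : ℝ} {φ : ℝ → ℝ}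
    (hconc : ConcaveOn ℝ (Set.Ici t₀) φ) (hzero : φ t₀ = 0) {s t : ℝ} (hs : t₀ ≤ s)
    (hst : s ≤ t) : (s - t₀) * φ t ≤ (t - t₀) * φ s := by
  rcases (hs.trans hst).eq_or_lt with rfl | ht
  · obtain rfl : s = t₀ := le_antisymm hst hs
    simp
  have hpos : 0 < t - t₀ := sub_pos.2 ht
  have h := hconc.2 (mem_Ici.2 le_rfl) (mem_Ici.2 ht.le)
    (div_nonneg (sub_nonneg.2 hst) hpos.le) (div_nonneg (sub_nonneg.2 hs) hpos.le)
    (by field_simp; ring)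
  have hcomb : (t - s) / (t - t₀) * t₀ + (s - t₀) / (t - t₀) * t = s := by
    field_simp
    ring
  simp only [smul_eq_mul, hcomb, hzero, mul_zero, zero_add] at h
  rwa [div_mul_eq_mul_div, div_le_iff₀ hpos, mul_comm (φ s)] at h

/-- Pointwise quasi-subadditivity of a nondecreasing function that vanishes on `[0,t₀]` and is
concave on `[t₀,∞)`. -/
theorem ConcaveOn.map_add_le_of_monotoneOn {t₀ : ℝ} (ht₀ : 0 ≤ t₀) {φ : ℝ → ℝ}
    (hmono : MonotoneOn φ (Set.Ici 0)) (hvanish : ∀ t ∈ Set.Icc 0 t₀, φ t = 0)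
    (hconc : ConcaveOn ℝ (Set.Ici t₀) φ) {a b : ℝ} (ha : 0 ≤ a) (hb : 0 ≤ b) :
    φ (a + b) ≤ φ (2 * t₀) + 2 * φ a + 2 * φ b := by
  wlog hba : b ≤ a generalizing a b
  · have := this hb ha (le_of_not_ge hba)
    rw [add_comm b a] at this
    linarith
  have hnonneg : ∀ t, 0 ≤ t → 0 ≤ φ t := fun t ht =>
    (hvanish 0 ⟨le_rfl, ht₀⟩).symm.le.trans (hmono (mem_Ici.2 le_rfl) (mem_Ici.2 ht) ht)
  have hφa := hnonneg a ha
  have hφb := hnonneg b hb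
  rcases le_total a t₀ with hat | hat
  · have : φ (a + b) ≤ φ (2 * t₀) :=
      hmono (mem_Ici.2 (by linarith)) (mem_Ici.2 (by linarith)) (by linarith)
    linarith
  have hle : φ (a + b) ≤ φ (2 * a) :=
    hmono (mem_Ici.2 (by linarith)) (mem_Ici.2 (by linarith)) (by linarith)
  have hzero : φ t₀ = 0 := hvanish t₀ ⟨ht₀, le_rfl⟩
  have h₁ := hconc.sub_mul_le_sub_mul_of_eq_zero hzero hat (t := 2 * a) (by linarith)
  have h₂ := hconc.sub_mul_le_sub_mul_of_eq_zero hzero (s := 2 * t₀) (t := 2 * a)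
    (by linarith) (by linarith)
  have hkey : φ (2 * a) ≤ φ (2 * t₀) + 2 * φ a := by
    rcases (show t₀ ≤ 2 * a by linarith).eq_or_lt with h | h
    · rw [← h, hzero]
      have := hnonneg (2 * t₀) (by linarith)
      linarith
    · refine le_of_mul_le_mul_left ?_ (sub_pos.2 h)
      linarith
  linarith

/-- A function that is monotone on `[0,∞)` composed with a nonnegative measurable function is
measurable. -/
theorem MonotoneOn.measurable_comp_of_nonneg {Ω : Type*} [MeasurableSpace Ω] {φ : ℝ → ℝ}
    (hmono : MonotoneOn φ (Set.Ici 0)) {A : Ω → ℝ} (hA : Measurable A) (hA0 : ∀ x, 0 ≤ A x) :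
    Measurable fun x => φ (A x) := by
  have hmax : Monotone fun t : ℝ => φ (max t 0) := fun s t hst =>
    hmono (mem_Ici.2 (le_max_right _ _)) (mem_Ici.2 (le_max_right _ _)) (max_le_max_right 0 hst)
  simpa [Function.comp_def, max_eq_left (hA0 _)] using hmax.measurable.comp hA

/-- The layer-cake substitute for subadditivity used in the proof of Theorem 1.3: if
`t₀ ≥ 0` and `φ : [0,∞) → [0,∞)` is nondecreasing, vanishes on `[0,t₀]` and is concave on
`[t₀,∞)`, then for a finite measure `μ` and measurable `A, B : Ω → [0,∞)` one has
`∫ φ(A+B) dμ ≤ μ(Ω) φ(2t₀) + 2 ∫ φ(A) dμ + 2 ∫ φ(B) dμ`. -/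
theorem layer_cake_quasi_subadditivity {Ω : Type*} [MeasurableSpace Ω]
    (μ : Measure Ω) [IsFiniteMeasure μ]
    (t₀ : ℝ) (ht₀ : 0 ≤ t₀) (φ : ℝ → ℝ)
    (hmono : MonotoneOn φ (Set.Ici 0))
    (hvanish : ∀ t ∈ Set.Icc 0 t₀, φ t = 0)
    (hconc : ConcaveOn ℝ (Set.Ici t₀) φ)
    (A B : Ω → ℝ) (hA : Measurable A) (hB : Measurable B)
    (hA0 : ∀ x, 0 ≤ A x) (hB0 : ∀ x, 0 ≤ B x) :
    ∫⁻ x, ENNReal.ofReal (φ (A x + B x)) ∂μ ≤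
      μ Set.univ * ENNReal.ofReal (φ (2 * t₀))
        + 2 * ∫⁻ x, ENNReal.ofReal (φ (A x)) ∂μ
        + 2 * ∫⁻ x, ENNReal.ofReal (φ (B x)) ∂μ := by
  have hφA := (hmono.measurable_comp_of_nonneg hA hA0).ennreal_ofReal
  have hφB := (hmono.measurable_comp_of_nonneg hB hB0).ennreal_ofReal
  have hpoint : ∀ x, ENNReal.ofReal (φ (A x + B x)) ≤ ENNReal.ofReal (φ (2 * t₀))
      + 2 * ENNReal.ofReal (φ (A x)) + 2 * ENNReal.ofReal (φ (B x)) := fun x => by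
    have h := ENNReal.ofReal_le_ofReal
      (hconc.map_add_le_of_monotoneOn ht₀ hmono hvanish (hA0 x) (hB0 x))
    refine h.trans (ENNReal.ofReal_add_le.trans ?_)
    refine (add_le_add_left ENNReal.ofReal_add_le _).trans ?_
    simp [ENNReal.ofReal_mul]
  calc ∫⁻ x, ENNReal.ofReal (φ (A x + B x)) ∂μ
      ≤ ∫⁻ x, (ENNReal.ofReal (φ (2 * t₀)) + 2 * ENNReal.ofReal (φ (A x))
          + 2 * ENNReal.ofReal (φ (B x))) ∂μ := lintegral_mono hpoint
    _ = _ := by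
      rw [lintegral_add_right _ (hφB.const_mul 2), lintegral_add_right _ (hφA.const_mul 2),
        lintegral_const_mul _ hφA, lintegral_const_mul _ hφB, lintegral_const, mul_comm (μ univ)]
end
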